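/- Characterization of extreme counterfactuals via the dual over the open feasible set (Lemma 3): under Assumptions Φ(i), Φ(ii) and M(i)–(iii), the smallest and largest counterfactuals satisfy κ̲(N_δ) = inf_{θ∈Θ_δ} κ̲*_δ(θ;γ0,P0) and κ̄(N_δ) = sup_{θ∈Θ_δ} κ̄*_δ(θ;γ0,P0) in the explicit-dependence case; in the implicit-dependence case (where k depends only on (θ,γ)), κ̲(N_δ) = inf_{θ∈Θ_δ} k(θ,γ0) and κ̄(N_δ) = sup_{θ∈Θ_δ} k(θ,γ0). -/

import Mathlib

open MeasureTheory Filter Set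
open scoped ENNReal Pointwise Classical

noncomputable section

namespace CFSens

/-- map an extended real to `ℝ≥0∞` (negatives go to `0`; only used on nonnegative values). -/
def erealToENNReal (x : EReal) : ℝ≥0∞ := if x = ⊤ then ⊤ else ENNReal.ofReal x.toReal

/-- Euclidean dot product. -/
def dot {ι : Type*} [Fintype ι] (a b : ι → ℝ) : ℝ := ∑ i, a i * b i

/-- Convex conjugate `φ*(x) = sup_{t ≥ 0} (t x - φ t)` (`EReal`-valued). -/
def phiStar (φ : ℝ → ℝ) (x : ℝ) : EReal :=
  ⨆ t ∈ Set.Ici (0:ℝ), ((t * x - φ t : ℝ) : EReal)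

/-- Convex conjugate `(ηφ)*(x) = sup_{t ≥ 0} (t x - η φ t)` of `ηφ`, for `η ≥ 0`. -/
def etaPhiStar (φ : ℝ → ℝ) (η x : ℝ) : EReal :=
  ⨆ t ∈ Set.Ici (0:ℝ), ((t * x - η * φ t : ℝ) : EReal)

/-- `ψ(x) = φ*(x) - x`. -/
def psi (φ : ℝ → ℝ) (x : ℝ) : EReal := phiStar φ x - (x : EReal)

/-- Assumption Φ(i).  Here `φ : ℝ → ℝ` records the (finite) values of the divergence cost
on `[0,∞)`; the paper's extension `φ(x) = +∞` for `x < 0` is encoded separately wherever it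
matters (nonnegativity of densities), and `φ(0) < ∞` is automatic since `φ` is real-valued. -/
structure PhiOne (φ : ℝ → ℝ) : Prop where
  smooth : ContDiffOn ℝ 2 φ (Set.Ioi (0:ℝ))
  sconvex : StrictConvexOn ℝ (Set.Ici (0:ℝ)) φ
  one : φ 1 = 0
  done : deriv φ 1 = 0
  superlinear : Tendsto (fun x => φ x / x) atTop atTop
  dzero : ∃ L : EReal, L < 0 ∧
    Tendsto (fun x => ((deriv φ x : ℝ) : EReal)) (nhdsWithin 0 (Set.Ioi 0)) (nhds L)
  dinfty : ∃ L : EReal, 0 < L ∧ Tendsto (fun x => ((deriv φ x : ℝ) : EReal)) atTop (nhds L)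
  delta2 : ∃ L : ℝ, Tendsto (fun x => x * deriv φ x / φ x) atTop (nhds L)

variable {U : Type*} [MeasurableSpace U] {dθ d1 d2 d3 d4 : ℕ} {Γ : Type*}

/-- Stacked moment values/multipliers `(v1,v2,v3,v4)`. -/
abbrev Vec4 (d1 d2 d3 d4 : ℕ) :=
  (Fin d1 → ℝ) × (Fin d2 → ℝ) × (Fin d3 → ℝ) × (Fin d4 → ℝ)

/-- The targeted moments `P = (P1,P2)`. -/
abbrev Vec12 (d1 d2 : ℕ) := (Fin d1 → ℝ) × (Fin d2 → ℝ)

/-- `λ'g` for stacked vectors. -/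
def dot4 (a b : Vec4 d1 d2 d3 d4) : ℝ :=
  dot a.1 b.1 + dot a.2.1 b.2.1 + dot a.2.2.1 b.2.2.1 + dot a.2.2.2 b.2.2.2

/-- dot product on `Vec12`. -/
def dot12 (a b : Vec12 d1 d2) : ℝ := dot a.1 b.1 + dot a.2 b.2

/-- `λ ∈ Λ`, i.e. the multipliers on the inequality constraints are nonnegative. -/
def inLambda (l : Vec4 d1 d2 d3 d4) : Prop := (∀ i, 0 ≤ l.1 i) ∧ (∀ i, 0 ≤ l.2.2.1 i)

/-- `λ12'P`. -/
def dotP (l : Vec4 d1 d2 d3 d4) (P : Vec12 d1 d2) : ℝ := dot l.1 P.1 + dot l.2.1 P.2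

/-- The φ-divergence `D_φ(F‖F*)` (`= +∞` unless `F ≪ F*`). -/
def Dphi (φ : ℝ → ℝ) (Fstar F : Measure U) : ℝ≥0∞ :=
  if F ≪ Fstar then ∫⁻ u, ENNReal.ofReal (φ (F.rnDeriv Fstar u).toReal) ∂Fstar else ⊤

/-- Membership in the Orlicz heart `ℰ`: `∫ ψ(c|f|) dF* < ∞` for all `c > 0`. -/
def MemE (φ : ℝ → ℝ) (Fstar : Measure U) (f : U → ℝ) : Prop :=
  Measurable f ∧ ∀ c : ℝ, 0 < c → ∫⁻ u, erealToENNReal (psi φ (c * |f u|)) ∂Fstar < ⊤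

/-- The Orlicz norm `‖f‖_ψ = inf_{c>0} c⁻¹ (1 + ∫ ψ(c|f|) dF*)`. -/
def psiNorm (φ : ℝ → ℝ) (Fstar : Measure U) (f : U → ℝ) : ℝ≥0∞ :=
  ⨅ c ∈ Set.Ioi (0:ℝ),
    (ENNReal.ofReal c)⁻¹ * (1 + ∫⁻ u, erealToENNReal (psi φ (c * |f u|)) ∂Fstar)

/-- `E^{F*}[f]` for an `EReal`-valued integrand bounded below by `-c`. -/
def eExp (Fstar : Measure U) (c : ℝ) (f : U → EReal) : EReal :=
  ((∫⁻ u, erealToENNReal (f u + (c : EReal)) ∂Fstar : ℝ≥0∞) : EReal) - (c : EReal)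

/-- Sequential lower hemicontinuity of a correspondence `A` (sequences taken in `S`). -/
def LowerHemicontinuousAt {α β : Type*} [TopologicalSpace α] [TopologicalSpace β]
    (A : α → Set β) (S : Set α) (x : α) : Prop :=
  ∀ xs : ℕ → α, (∀ n, xs n ∈ S) → Tendsto xs atTop (nhds x) →
    ∀ y ∈ A x, ∃ ys : ℕ → β, (∀ n, ys n ∈ A (xs n)) ∧ Tendsto ys atTop (nhds y)

section Model

variable (φ : ℝ → ℝ) (Fstar : Measure U)
variable (g : U → (Fin dθ → ℝ) → Γ → Vec4 d1 d2 d3 d4)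
variable (k : U → (Fin dθ → ℝ) → Γ → ℝ)

/-- All components of `g(·,θ,γ)` are integrable under `F`. -/
def GIntegrable (θ : Fin dθ → ℝ) (γ : Γ) (F : Measure U) : Prop :=
  (∀ i, Integrable (fun u => (g u θ γ).1 i) F) ∧
  (∀ i, Integrable (fun u => (g u θ γ).2.1 i) F) ∧
  (∀ i, Integrable (fun u => (g u θ γ).2.2.1 i) F) ∧
  (∀ i, Integrable (fun u => (g u θ γ).2.2.2 i) F)

/-- The model constraints (1)–(4): `E^F[g1] ≤ P1`, `E^F[g2] = P2`, `E^F[g3] ≤ 0`, `E^F[g4] = 0`. -/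
def ConstraintsHold (θ : Fin dθ → ℝ) (γ : Γ) (P : Vec12 d1 d2) (F : Measure U) : Prop :=
  GIntegrable g θ γ F ∧
  (∀ i, ∫ u, (g u θ γ).1 i ∂F ≤ P.1 i) ∧
  (∀ i, ∫ u, (g u θ γ).2.1 i ∂F = P.2 i) ∧
  (∀ i, ∫ u, (g u θ γ).2.2.1 i ∂F ≤ 0) ∧
  (∀ i, ∫ u, (g u θ γ).2.2.2 i ∂F = 0)

/-- `F ∈ N_δ` and the model constraints hold at `(θ,γ,P)` under `F`. -/
def Feasible (δ : ℝ) (θ : Fin dθ → ℝ) (γ : Γ) (P : Vec12 d1 d2) (F : Measure U) : Prop :=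
  IsProbabilityMeasure F ∧ Dphi φ Fstar F ≤ ENNReal.ofReal δ ∧ ConstraintsHold g θ γ P F

/-- `κ̲_δ(θ;γ,P)`: primal lower value (explicit-dependence case); `= ⊤` if infeasible. -/
def kappaLow (δ : ℝ) (θ : Fin dθ → ℝ) (γ : Γ) (P : Vec12 d1 d2) : EReal :=
  sInf {x : EReal | ∃ F : Measure U, Feasible φ Fstar g δ θ γ P F ∧
    Integrable (fun u => k u θ γ) F ∧ x = ((∫ u, k u θ γ ∂F : ℝ) : EReal)}

/-- `κ̄_δ(θ;γ,P)`: primal upper value (explicit-dependence case); `= ⊥` if infeasible. -/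
def kappaHigh (δ : ℝ) (θ : Fin dθ → ℝ) (γ : Γ) (P : Vec12 d1 d2) : EReal :=
  sSup {x : EReal | ∃ F : Measure U, Feasible φ Fstar g δ θ γ P F ∧
    Integrable (fun u => k u θ γ) F ∧ x = ((∫ u, k u θ γ ∂F : ℝ) : EReal)}

/-- `κ̲*_δ(θ;γ,P)`: the dual program of `κ̲_δ`.  Multipliers with
`E^{F*}[(ηφ)*(...)] = +∞` contribute `-∞` to the supremum and are omitted from the
index set; `w` is a real-valued integrable version of the conjugate integrand. -/
def kappaLowDual (δ : ℝ) (θ : Fin dθ → ℝ) (γ : Γ) (P : Vec12 d1 d2) : EReal :=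
  sSup {x : EReal | ∃ η : ℝ, 0 ≤ η ∧ ∃ ζ : ℝ, ∃ l : Vec4 d1 d2 d3 d4, inLambda l ∧
    ∃ w : U → ℝ, Integrable w Fstar ∧
      (∀ᵐ u ∂Fstar, (w u : EReal) = etaPhiStar φ η (-(k u θ γ) - ζ - dot4 l (g u θ γ))) ∧
      x = ((-(∫ u, w u ∂Fstar) - η * δ - ζ - dotP l P : ℝ) : EReal)}

/-- `κ̄*_δ(θ;γ,P)`: the dual program of `κ̄_δ`. -/
def kappaHighDual (δ : ℝ) (θ : Fin dθ → ℝ) (γ : Γ) (P : Vec12 d1 d2) : EReal :=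
  sInf {x : EReal | ∃ η : ℝ, 0 ≤ η ∧ ∃ ζ : ℝ, ∃ l : Vec4 d1 d2 d3 d4, inLambda l ∧
    ∃ w : U → ℝ, Integrable w Fstar ∧
      (∀ᵐ u ∂Fstar, (w u : EReal) = etaPhiStar φ η (k u θ γ - ζ - dot4 l (g u θ γ))) ∧
      x = (((∫ u, w u ∂Fstar) + η * δ + ζ + dotP l P : ℝ) : EReal)}

/-- `δ*(θ;γ,P) = sup_{ζ,λ∈Λ} ( -E^{F*}[φ*(-ζ-λ'g)] - ζ - λ12'P )`. -/
def deltaStar (θ : Fin dθ → ℝ) (γ : Γ) (P : Vec12 d1 d2) : EReal :=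
  sSup {x : EReal | ∃ ζ : ℝ, ∃ l : Vec4 d1 d2 d3 d4, inLambda l ∧
    ∃ w : U → ℝ, Integrable w Fstar ∧
      (∀ᵐ u ∂Fstar, (w u : EReal) = phiStar φ (-ζ - dot4 l (g u θ γ))) ∧
      x = ((-(∫ u, w u ∂Fstar) - ζ - dotP l P : ℝ) : EReal)}

/-- `{E^F[g(U,θ,γ)] : F ∈ N_∞}`. -/
def momentSet (θ : Fin dθ → ℝ) (γ : Γ) : Set (Vec4 d1 d2 d3 d4) :=
  {v | ∃ F : Measure U, IsProbabilityMeasure F ∧ Dphi φ Fstar F < ⊤ ∧ GIntegrable g θ γ F ∧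
    v = ((fun i => ∫ u, (g u θ γ).1 i ∂F), (fun i => ∫ u, (g u θ γ).2.1 i ∂F),
         (fun i => ∫ u, (g u θ γ).2.2.1 i ∂F), (fun i => ∫ u, (g u θ γ).2.2.2 i ∂F))}

/-- The cone `𝒞 = ℝ^{d1}_{≥0} × {0} × ℝ^{d3}_{≥0} × {0}`. -/
def coneC : Set (Vec4 d1 d2 d3 d4) :=
  {c | (∀ i, 0 ≤ c.1 i) ∧ c.2.1 = 0 ∧ (∀ i, 0 ≤ c.2.2.1 i) ∧ c.2.2.2 = 0}

/-- Condition S at `(θ,γ,P)`. -/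
def ConditionS (θ : Fin dθ → ℝ) (γ : Γ) (P : Vec12 d1 d2) : Prop :=
  ((P.1, P.2, (0 : Fin d3 → ℝ), (0 : Fin d4 → ℝ)) : Vec4 d1 d2 d3 d4) ∈
    interior (momentSet φ Fstar g θ γ + coneC)

/-- Assumption Φ(ii): `k(·,θ,γ)` and each component of `g(·,θ,γ)` lie in `ℰ`. -/
def PhiTwo : Prop :=
  ∀ (θ : Fin dθ → ℝ) (γ : Γ), MemE φ Fstar (fun u => k u θ γ) ∧
    (∀ i, MemE φ Fstar (fun u => (g u θ γ).1 i)) ∧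
    (∀ i, MemE φ Fstar (fun u => (g u θ γ).2.1 i)) ∧
    (∀ i, MemE φ Fstar (fun u => (g u θ γ).2.2.1 i)) ∧
    (∀ i, MemE φ Fstar (fun u => (g u θ γ).2.2.2 i))

/-- `Θ_δ = {θ ∈ Θ : δ*(θ;γ0,P0) < δ}`. -/
def ThetaDelta (Θ : Set (Fin dθ → ℝ)) (γ0 : Γ) (P0 : Vec12 d1 d2) (δ : ℝ) :
    Set (Fin dθ → ℝ) :=
  {θ ∈ Θ | deltaStar φ Fstar g θ γ0 P0 < ((δ : ℝ) : EReal)}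

/-- Implicit-dependence lower value: `kI(θ,γ)` if feasible, `+∞` otherwise. -/
def kappaLowImp (kI : (Fin dθ → ℝ) → Γ → ℝ) (δ : ℝ) (θ : Fin dθ → ℝ) (γ : Γ)
    (P : Vec12 d1 d2) : EReal :=
  sInf {x : EReal | ∃ F : Measure U, Feasible φ Fstar g δ θ γ P F ∧ x = ((kI θ γ : ℝ) : EReal)}

/-- Implicit-dependence upper value: `kI(θ,γ)` if feasible, `-∞` otherwise. -/
def kappaHighImp (kI : (Fin dθ → ℝ) → Γ → ℝ) (δ : ℝ) (θ : Fin dθ → ℝ) (γ : Γ)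
    (P : Vec12 d1 d2) : EReal :=
  sSup {x : EReal | ∃ F : Measure U, Feasible φ Fstar g δ θ γ P F ∧ x = ((kI θ γ : ℝ) : EReal)}

/-- The criterion `K̲_δ(θ;γ,P)`. -/
def KLowCrit (δ : ℝ) (θ : Fin dθ → ℝ) (γ : Γ) (P : Vec12 d1 d2) : EReal :=
  if deltaStar φ Fstar g θ γ P < ((δ : ℝ) : EReal) then kappaLowDual φ Fstar g k δ θ γ P
  else if deltaStar φ Fstar g θ γ P = ((δ : ℝ) : EReal) then kappaLow φ Fstar g k δ θ γ P
  else ⊤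

/-- The criterion `K̄_δ(θ;γ,P)`. -/
def KHighCrit (δ : ℝ) (θ : Fin dθ → ℝ) (γ : Γ) (P : Vec12 d1 d2) : EReal :=
  if deltaStar φ Fstar g θ γ P < ((δ : ℝ) : EReal) then kappaHighDual φ Fstar g k δ θ γ P
  else if deltaStar φ Fstar g θ γ P = ((δ : ℝ) : EReal) then kappaHigh φ Fstar g k δ θ γ P
  else ⊥

/-- ℰ-continuity of a family `f(·,θ,γ)` in `(θ,γ)` on `Θ × Γ`. -/
def EContinuousIn [TopologicalSpace Γ] (Θ : Set (Fin dθ → ℝ))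
    (f : U → (Fin dθ → ℝ) → Γ → ℝ) : Prop :=
  ∀ θ0 ∈ Θ, ∀ γ0 : Γ,
    Tendsto (fun p : (Fin dθ → ℝ) × Γ => psiNorm φ Fstar (fun u => f u p.1 p.2 - f u θ0 γ0))
      (nhdsWithin (θ0, γ0) (Θ ×ˢ (Set.univ : Set Γ))) (nhds 0)

/-- Assumption M(i) for the moment functions. -/
def MOneG [TopologicalSpace Γ] (Θ : Set (Fin dθ → ℝ)) : Prop :=
  (∀ i, EContinuousIn φ Fstar Θ (fun u θ γ => (g u θ γ).1 i)) ∧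
  (∀ i, EContinuousIn φ Fstar Θ (fun u θ γ => (g u θ γ).2.1 i)) ∧
  (∀ i, EContinuousIn φ Fstar Θ (fun u θ γ => (g u θ γ).2.2.1 i)) ∧
  (∀ i, EContinuousIn φ Fstar Θ (fun u θ γ => (g u θ γ).2.2.2 i))

/-- Assumption M(v). -/
def MFive [TopologicalSpace Γ] (Θ : Set (Fin dθ → ℝ)) : Prop :=
  ∀ (c1 c2 : ℝ) (c3 : Vec4 d1 d2 d3 d4), ContinuousOn
    (fun p : (Fin dθ → ℝ) × Γ =>
      eExp Fstar (φ 0) (fun u => phiStar φ (c1 + c2 * k u p.1 p.2 + dot4 c3 (g u p.1 p.2))))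
    (Θ ×ˢ (Set.univ : Set Γ))

/-- Objective of the dual program for the lower value, as a function of `(η,ζ,λ)`. -/
def lowObj (δ : ℝ) (θ : Fin dθ → ℝ) (γ : Γ) (P : Vec12 d1 d2) (η ζ : ℝ)
    (l : Vec4 d1 d2 d3 d4) : EReal :=
  -(eExp Fstar (η * φ 0) (fun u => etaPhiStar φ η (-(k u θ γ) - ζ - dot4 l (g u θ γ))))
    - ((η * δ : ℝ) : EReal) - ((ζ : ℝ) : EReal) - ((dotP l P : ℝ) : EReal)

/-- Objective of the dual program for the upper value. -/
def highObj (δ : ℝ) (θ : Fin dθ → ℝ) (γ : Γ) (P : Vec12 d1 d2) (η ζ : ℝ)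
    (l : Vec4 d1 d2 d3 d4) : EReal :=
  (eExp Fstar (η * φ 0) (fun u => etaPhiStar φ η (k u θ γ - ζ - dot4 l (g u θ γ))))
    + ((η * δ : ℝ) : EReal) + ((ζ : ℝ) : EReal) + ((dotP l P : ℝ) : EReal)

/-- `Ξ̲_δ(θ)`: maximizers of the lower dual program. -/
def XiLow (δ : ℝ) (θ : Fin dθ → ℝ) (γ : Γ) (P : Vec12 d1 d2) :
    Set (ℝ × ℝ × Vec4 d1 d2 d3 d4) :=
  {ξ | 0 ≤ ξ.1 ∧ inLambda ξ.2.2 ∧ ∀ ξ' : ℝ × ℝ × Vec4 d1 d2 d3 d4, 0 ≤ ξ'.1 → inLambda ξ'.2.2 →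
    lowObj φ Fstar g k δ θ γ P ξ'.1 ξ'.2.1 ξ'.2.2 ≤ lowObj φ Fstar g k δ θ γ P ξ.1 ξ.2.1 ξ.2.2}

/-- `Ξ̄_δ(θ)`: minimizers of the upper dual program. -/
def XiHigh (δ : ℝ) (θ : Fin dθ → ℝ) (γ : Γ) (P : Vec12 d1 d2) :
    Set (ℝ × ℝ × Vec4 d1 d2 d3 d4) :=
  {ξ | 0 ≤ ξ.1 ∧ inLambda ξ.2.2 ∧ ∀ ξ' : ℝ × ℝ × Vec4 d1 d2 d3 d4, 0 ≤ ξ'.1 → inLambda ξ'.2.2 →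
    highObj φ Fstar g k δ θ γ P ξ.1 ξ.2.1 ξ.2.2 ≤ highObj φ Fstar g k δ θ γ P ξ'.1 ξ'.2.1 ξ'.2.2}

/-- `Λ̲_δ(θ)`: `(λ1,λ2)`-projections of `Ξ̲_δ(θ)`. -/
def LamLow (δ : ℝ) (θ : Fin dθ → ℝ) (γ : Γ) (P : Vec12 d1 d2) : Set (Vec12 d1 d2) :=
  {p | ∃ ξ ∈ XiLow φ Fstar g k δ θ γ P, ξ.2.2.1 = p.1 ∧ ξ.2.2.2.1 = p.2}

/-- `Λ̄_δ(θ)`: `(λ1,λ2)`-projections of `Ξ̄_δ(θ)`. -/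
def LamHigh (δ : ℝ) (θ : Fin dθ → ℝ) (γ : Γ) (P : Vec12 d1 d2) : Set (Vec12 d1 d2) :=
  {p | ∃ ξ ∈ XiHigh φ Fstar g k δ θ γ P, ξ.2.2.1 = p.1 ∧ ξ.2.2.2.1 = p.2}

end Model

end CFSens

namespace CFSens

/-! ### The divergence cost and its conjugate -/

section Cost

variable {φ : ℝ → ℝ}

lemma PhiOne.convexOn (h : PhiOne φ) : ConvexOn ℝ (Ici (0 : ℝ)) φ := h.sconvex.convexOn

lemma PhiOne.continuousOn (h : PhiOne φ) : ContinuousOn φ (Ioi (0 : ℝ)) := h.smooth.continuousOn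

lemma PhiOne.hasDerivAt_one (h : PhiOne φ) : HasDerivAt φ 0 1 := by
  have h1 : DifferentiableAt ℝ φ 1 :=
    (h.smooth.differentiableOn (by norm_num)).differentiableAt (Ioi_mem_nhds one_pos)
  simpa [h.done] using h1.hasDerivAt

lemma PhiOne.nonneg (h : PhiOne φ) {t : ℝ} (ht : 0 ≤ t) : 0 ≤ φ t := by
  have h1 := h.convexOn.isMinOn_of_rightDeriv_eq_zero (x := 1) (by simp)
    (h.hasDerivAt_one.hasDerivWithinAt.derivWithin (uniqueDiffWithinAt_Ioi 1))
  simpa [h.one] using h1 (show t ∈ Ici (0 : ℝ) from ht)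

lemma PhiOne.measurable_comp (h : PhiOne φ) {U : Type*} [MeasurableSpace U] {f : U → ℝ}
    (hf : Measurable f) (h0 : ∀ u, 0 ≤ f u) : Measurable (fun u => φ (f u)) := by
  have h1 : Measurable ((Ioi (0 : ℝ)).piecewise φ (fun _ => φ 0)) :=
    h.continuousOn.measurable_piecewise continuousOn_const measurableSet_Ioi
  have h2 : (fun u => φ (f u)) = (Ioi (0 : ℝ)).piecewise φ (fun _ => φ 0) ∘ f := by
    funext u
    rcases (h0 u).lt_or_eq with h2 | h2
    · simp [h2]
    · simp [← h2]
  rw [h2]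
  exact h1.comp hf

/-- The real-valued convex conjugate of the divergence cost. -/
def conj (φ : ℝ → ℝ) (x : ℝ) : ℝ := ⨆ t : Ici (0 : ℝ), (t * x - φ t)

lemma PhiOne.bddAbove_conj (h : PhiOne φ) (x : ℝ) :
    BddAbove (range fun t : Ici (0 : ℝ) => (t * x - φ t)) := by
  obtain ⟨T, hT⟩ := eventually_atTop.1 (h.superlinear.eventually_ge_atTop x)
  refine ⟨max T 1 * |x|, ?_⟩
  rintro _ ⟨⟨t, ht⟩, rfl⟩
  have ht' : 0 ≤ t := ht
  have hφ := h.nonneg ht'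
  simp only
  by_cases h1 : max T 1 ≤ t
  · have h2 := hT t (le_trans (le_max_left _ _) h1)
    have h3 : 0 < t := lt_of_lt_of_le (by positivity) h1
    rw [le_div_iff₀ h3] at h2
    have : 0 ≤ max T 1 * |x| := by positivity
    nlinarith
  · have h2 : t * x ≤ t * |x| := mul_le_mul_of_nonneg_left (le_abs_self x) ht'
    have h3 : t * |x| ≤ max T 1 * |x| := mul_le_mul_of_nonneg_right (le_of_not_ge h1) (abs_nonneg x)
    linarith

lemma PhiOne.mul_le_conj (h : PhiOne φ) {t : ℝ} (ht : 0 ≤ t) (x : ℝ) :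
    t * x ≤ φ t + conj φ x := by
  have := le_ciSup (h.bddAbove_conj x) ⟨t, ht⟩
  simp only at this
  unfold conj
  linarith

lemma PhiOne.conj_mono (h : PhiOne φ) : Monotone (conj φ) := by
  intro x y hxy
  have : Nonempty (Ici (0 : ℝ)) := ⟨⟨0, by simp⟩⟩
  refine ciSup_mono (h.bddAbove_conj y) fun t => ?_
  have := mul_le_mul_of_nonneg_left hxy t.2
  linarith

lemma PhiOne.phiStar_eq (h : PhiOne φ) (x : ℝ) : phiStar φ x = (conj φ x : EReal) := by
  have : Nonempty (Ici (0 : ℝ)) := ⟨⟨0, by simp⟩⟩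
  apply le_antisymm
  · refine iSup₂_le fun t ht => ?_
    have := h.mul_le_conj ht x
    exact_mod_cast (by linarith : t * x - φ t ≤ conj φ x)
  · by_contra hlt
    rw [not_le] at hlt
    obtain ⟨q, hq1, hq2⟩ := EReal.lt_iff_exists_real_btwn.1 hlt
    obtain ⟨t, ht⟩ := exists_lt_of_lt_ciSup (show q < _ from by exact_mod_cast hq2)
    have h1 : ((t * x - φ t : ℝ) : EReal) ≤ phiStar φ x :=
      le_iSup₂_of_le (f := fun (t : ℝ) (_ : t ∈ Ici (0:ℝ)) => ((t * x - φ t : ℝ) : EReal))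
        t.1 t.2 le_rfl
    have h2 : (q : EReal) < ((t * x - φ t : ℝ) : EReal) := by exact_mod_cast ht
    exact absurd (h2.trans_le h1) (not_lt.2 hq1.le)

lemma etaPhiStar_one (φ : ℝ → ℝ) (x : ℝ) : etaPhiStar φ 1 x = phiStar φ x := by
  simp [etaPhiStar, phiStar]

lemma PhiOne.le_conj (h : PhiOne φ) (x : ℝ) : x ≤ conj φ x := by
  have := h.mul_le_conj zero_le_one x
  rw [h.one] at this
  linarith

lemma PhiOne.conj_le (h : PhiOne φ) (x : ℝ) : conj φ x ≤ 2 * (conj φ x - x) + φ 2 := by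
  have := h.mul_le_conj zero_le_two x
  linarith

lemma PhiOne.erealToENNReal_psi (h : PhiOne φ) (x : ℝ) :
    erealToENNReal (psi φ x) = ENNReal.ofReal (conj φ x - x) := by
  rw [psi, h.phiStar_eq, ← EReal.coe_sub, erealToENNReal, if_neg (EReal.coe_ne_top _),
    EReal.toReal_coe]

/-- The midpoint convexity gap of the divergence cost. -/
def gap (φ : ℝ → ℝ) (a b : ℝ) : ℝ := φ a / 2 + φ b / 2 - φ ((a + b) / 2)

lemma PhiOne.gap_nonneg (h : PhiOne φ) {a b : ℝ} (ha : 0 ≤ a) (hb : 0 ≤ b) : 0 ≤ gap φ a b := by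
  have := h.convexOn.2 (show a ∈ Ici (0 : ℝ) from ha) (show b ∈ Ici (0 : ℝ) from hb)
    (by norm_num : (0 : ℝ) ≤ 1 / 2) (by norm_num : (0 : ℝ) ≤ 1 / 2) (by norm_num)
  simp only [smul_eq_mul] at this
  rw [show 1 / 2 * a + 1 / 2 * b = (a + b) / 2 by ring] at this
  unfold gap
  linarith

lemma PhiOne.gap_pos (h : PhiOne φ) {a b : ℝ} (ha : 0 ≤ a) (hb : 0 ≤ b) (hab : a ≠ b) :
    0 < gap φ a b := by
  have := h.sconvex.2 (show a ∈ Ici (0 : ℝ) from ha) (show b ∈ Ici (0 : ℝ) from hb) hab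
    (by norm_num : (0 : ℝ) < 1 / 2) (by norm_num : (0 : ℝ) < 1 / 2) (by norm_num)
  simp only [smul_eq_mul] at this
  rw [show 1 / 2 * a + 1 / 2 * b = (a + b) / 2 by ring] at this
  unfold gap
  linarith

/-- The gap grows as the first argument moves away from the second one. -/
lemma PhiOne.gap_mono (h : PhiOne φ) {a a' b : ℝ} (ha' : 0 ≤ a') (ha : 0 ≤ a) (hb : 0 ≤ b)
    (hab : b < a ∧ a ≤ a' ∨ a' ≤ a ∧ a < b) : gap φ a b ≤ gap φ a' b := by
  have hm : 0 ≤ (a + b) / 2 := by positivity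
  obtain ⟨s, t, hs0, hs1, ht0, ht1, hst, h1, h2⟩ : ∃ s t : ℝ, 0 ≤ s ∧ s ≤ 1 ∧ 0 ≤ t ∧ t ≤ 1 ∧
      s + 2 * t = 1 ∧ (1 - s) * ((a + b) / 2) + s * a' = a ∧
      (1 - t) * ((a + b) / 2) + t * a' = (a' + b) / 2 := by
    obtain ⟨D, rfl⟩ : ∃ D, a' = (a + b) / 2 + D := ⟨a' - (a + b) / 2, by ring⟩
    have hd : D ≠ 0 := by
      rcases hab with ⟨h1, h2⟩ | ⟨h1, h2⟩
      · exact ne_of_gt (by linarith)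
      · exact ne_of_lt (by linarith)
    have hs : 0 ≤ (a - b) / 2 / D := by
      rcases hab with ⟨h1, h2⟩ | ⟨h1, h2⟩
      · exact div_nonneg (by linarith) (by linarith)
      · exact div_nonneg_of_nonpos (by linarith) (by linarith)
    have ht : 0 ≤ ((b - a) / 2 + D) / 2 / D := by
      rcases hab with ⟨h1, h2⟩ | ⟨h1, h2⟩
      · exact div_nonneg (by linarith) (by linarith)
      · exact div_nonneg_of_nonpos (by linarith) (by linarith)
    have hst : (a - b) / 2 / D + 2 * (((b - a) / 2 + D) / 2 / D) = 1 := by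
      field_simp
      ring
    refine ⟨_, _, hs, by linarith, ht, by linarith, hst, ?_, ?_⟩
    · field_simp
      ring
    · field_simp
      ring
  have e1 := h.convexOn.2 (show (a + b) / 2 ∈ Ici (0 : ℝ) from hm) (show a' ∈ Ici (0 : ℝ) from ha')
    (sub_nonneg.2 hs1) hs0 (by ring)
  have e2 := h.convexOn.2 (show (a + b) / 2 ∈ Ici (0 : ℝ) from hm) (show a' ∈ Ici (0 : ℝ) from ha')
    (sub_nonneg.2 ht1) ht0 (by ring)
  simp only [smul_eq_mul] at e1 e2
  rw [h1] at e1
  rw [h2] at e2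
  have hs' : s = 1 - 2 * t := by linarith
  subst hs'
  unfold gap
  nlinarith

lemma PhiOne.tendsto_of_gap (h : PhiOne φ) {x : ℕ → ℝ} {b : ℝ} (hx : ∀ n, 0 ≤ x n) (hb : 0 ≤ b)
    (hg : Tendsto (fun n => gap φ (x n) b) atTop (nhds 0)) : Tendsto x atTop (nhds b) := by
  refine tendsto_order.2 ⟨fun c hc => ?_, fun c hc => ?_⟩
  · rcases lt_or_ge c 0 with h0 | h0
    · exact Eventually.of_forall fun n => h0.trans_le (hx n)
    · filter_upwards [hg.eventually_lt_const (h.gap_pos h0 hb hc.ne)] with n hn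
      by_contra hcn
      exact absurd hn (not_lt.2 (h.gap_mono (hx n) h0 hb (Or.inr ⟨not_lt.1 hcn, hc⟩)))
  · have h0 : 0 ≤ c := hb.trans hc.le
    filter_upwards [hg.eventually_lt_const (h.gap_pos h0 hb hc.ne')] with n hn
    by_contra hcn
    exact absurd hn (not_lt.2 (h.gap_mono (hx n) h0 hb (Or.inl ⟨hc, not_lt.1 hcn⟩)))

end Cost
end CFSens

namespace CFSens

/-! ### Densities and the Orlicz heart -/

section Density

variable {U : Type*} [MeasurableSpace U] {φ : ℝ → ℝ} {μ : Measure U}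

/-- Nonnegative measurable functions with finite divergence integral. -/
structure IsDens (φ : ℝ → ℝ) (μ : Measure U) (f : U → ℝ) : Prop where
  meas : Measurable f
  nonneg : ∀ u, 0 ≤ f u
  int : Integrable (fun u => φ (f u)) μ

/-- The Orlicz heart, described through the conjugate `φ*` instead of `ψ`. -/
def Heart (φ : ℝ → ℝ) (μ : Measure U) (h : U → ℝ) : Prop :=
  Measurable h ∧ ∀ c : ℝ, 0 < c → Integrable (fun u => conj φ (c * |h u|)) μ

lemma MemE.heart (hΦ : PhiOne φ) {h : U → ℝ} (hh : MemE φ μ h) [IsFiniteMeasure μ] :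
    Heart φ μ h := by
  refine ⟨hh.1, fun c hc => ?_⟩
  have hm : Measurable fun u => c * |h u| := by have := hh.1; fun_prop
  have hm' : Measurable fun u => conj φ (c * |h u|) := hΦ.conj_mono.measurable.comp hm
  have h1 : Integrable (fun u => conj φ (c * |h u|) - c * |h u|) μ := by
    refine ⟨(hm'.sub hm).aestronglyMeasurable, ?_⟩
    rw [hasFiniteIntegral_iff_ofReal
      (Eventually.of_forall fun u => by simpa using hΦ.le_conj (c * |h u|))]
    simpa only [hΦ.erealToENNReal_psi] using hh.2 c hc
  refine ((h1.const_mul 2).add (integrable_const (φ 2))).mono' hm'.aestronglyMeasurable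
    (Eventually.of_forall fun u => ?_)
  have h0 : 0 ≤ c * |h u| := by positivity
  rw [Real.norm_of_nonneg (h0.trans (hΦ.le_conj _))]
  exact hΦ.conj_le _

lemma heart_const [IsFiniteMeasure μ] (c : ℝ) : Heart φ μ (fun _ => c) :=
  ⟨measurable_const, fun _ _ => integrable_const _⟩

lemma IsDens.mul_le (hΦ : PhiOne φ) {f : U → ℝ} (hf : IsDens φ μ f) (h : U → ℝ) (u : U)
    {c : ℝ} (hc : 0 < c) : |f u * h u| ≤ c⁻¹ * (φ (f u) + conj φ (c * |h u|)) := by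
  rw [abs_mul, abs_of_nonneg (hf.nonneg u), inv_mul_eq_div, le_div_iff₀ hc]
  have := hΦ.mul_le_conj (hf.nonneg u) (c * |h u|)
  linarith

lemma IsDens.integrable_mul (hΦ : PhiOne φ) {f h : U → ℝ} (hf : IsDens φ μ f)
    (hh : Heart φ μ h) : Integrable (fun u => f u * h u) μ := by
  refine ((hf.int.add (hh.2 1 one_pos)).const_mul (1⁻¹)).mono'
    (hf.meas.mul hh.1).aestronglyMeasurable (Eventually.of_forall fun u => ?_)
  exact hf.mul_le hΦ h u one_pos

lemma IsDens.const [IsFiniteMeasure μ] {c : ℝ} (hc : 0 ≤ c) : IsDens φ μ (fun _ => c) :=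
  ⟨measurable_const, fun _ => hc, integrable_const _⟩

lemma IsDens.integrable [IsFiniteMeasure μ] (hΦ : PhiOne φ) {f : U → ℝ} (hf : IsDens φ μ f) :
    Integrable f μ := by
  simpa using hf.integrable_mul hΦ (heart_const 1)

lemma Heart.integrable [IsFiniteMeasure μ] (hΦ : PhiOne φ) {h : U → ℝ} (hh : Heart φ μ h) :
    Integrable h μ := by
  simpa using (IsDens.const zero_le_one).integrable_mul hΦ hh

lemma IsDens.convex_comb (hΦ : PhiOne φ) {f₁ f₂ : U → ℝ} (h₁ : IsDens φ μ f₁)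
    (h₂ : IsDens φ μ f₂) {a b : ℝ} (ha : 0 ≤ a) (hb : 0 ≤ b) (hab : a + b = 1) :
    IsDens φ μ (fun u => a * f₁ u + b * f₂ u) ∧
      ∫ u, φ (a * f₁ u + b * f₂ u) ∂μ ≤ a * ∫ u, φ (f₁ u) ∂μ + b * ∫ u, φ (f₂ u) ∂μ := by
  have hm : Measurable (fun u => a * f₁ u + b * f₂ u) := (h₁.meas.const_mul a).add (h₂.meas.const_mul b)
  have h0 : ∀ u, 0 ≤ a * f₁ u + b * f₂ u := fun u =>
    add_nonneg (mul_nonneg ha (h₁.nonneg u)) (mul_nonneg hb (h₂.nonneg u))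
  have hle : ∀ u, φ (a * f₁ u + b * f₂ u) ≤ a * φ (f₁ u) + b * φ (f₂ u) := fun u => by
    simpa using hΦ.convexOn.2 (show f₁ u ∈ Ici (0 : ℝ) from h₁.nonneg u)
      (show f₂ u ∈ Ici (0 : ℝ) from h₂.nonneg u) ha hb hab
  have hi : Integrable (fun u => a * φ (f₁ u) + b * φ (f₂ u)) μ :=
    (h₁.int.const_mul a).add (h₂.int.const_mul b)
  have hi' : Integrable (fun u => φ (a * f₁ u + b * f₂ u)) μ := by
    refine hi.mono' (hΦ.measurable_comp hm h0).aestronglyMeasurable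
      (Eventually.of_forall fun u => ?_)
    rw [Real.norm_of_nonneg (hΦ.nonneg (h0 u))]
    exact hle u
  refine ⟨⟨hm, h0, hi'⟩, ?_⟩
  rw [← integral_const_mul, ← integral_const_mul,
    ← integral_add (h₁.int.const_mul a) (h₂.int.const_mul b)]
  exact integral_mono hi' hi hle

lemma IsDens.integral_comb_mul (hΦ : PhiOne φ) {f₁ f₂ h : U → ℝ} (h₁ : IsDens φ μ f₁)
    (h₂ : IsDens φ μ f₂) (hh : Heart φ μ h) (a b : ℝ) :
    ∫ u, (a * f₁ u + b * f₂ u) * h u ∂μ =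
      a * ∫ u, f₁ u * h u ∂μ + b * ∫ u, f₂ u * h u ∂μ := by
  rw [← integral_const_mul, ← integral_const_mul, ← integral_add
    ((h₁.integrable_mul hΦ hh).const_mul a) ((h₂.integrable_mul hΦ hh).const_mul b)]
  congr 1
  funext u
  ring

end Density

/-! ### Separation -/

/-- A point outside a nonempty convex set of a finite-dimensional space is weakly separated from
it by a nonzero functional. -/
lemma exists_ne_zero_le_of_notMem_convex {E : Type*} [NormedAddCommGroup E] [NormedSpace ℝ E]
    [FiniteDimensional ℝ E] {S : Set E} (hS : Convex ℝ S) (hne : S.Nonempty) {x : E}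
    (hx : x ∉ S) : ∃ ℓ : E →ₗ[ℝ] ℝ, ℓ ≠ 0 ∧ ∀ y ∈ S, ℓ x ≤ ℓ y := by
  by_cases hi : (interior S).Nonempty
  · obtain ⟨f, hf⟩ := geometric_hahn_banach_open_point hS.interior isOpen_interior
      (fun h => hx (interior_subset h))
    refine ⟨-(f : E →ₗ[ℝ] ℝ), fun h0 => ?_, fun y hy => ?_⟩
    · obtain ⟨y, hy⟩ := hi
      have h1 := hf y hy
      have h2 : ∀ z, f z = 0 := fun z => by simpa using LinearMap.congr_fun h0 z
      simp [h2] at h1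
    · have h1 : y ∈ closure (interior S) := by
        rw [hS.closure_interior_eq_closure_of_nonempty_interior hi]
        exact subset_closure hy
      have h2 : closure (interior S) ⊆ {z | f z ≤ f x} :=
        closure_minimal (fun z hz => (hf z hz).le) (isClosed_le f.continuous continuous_const)
      simpa using h2 h1
  · rw [hS.interior_nonempty_iff_affineSpan_eq_top] at hi
    obtain ⟨y₀, hy₀⟩ := hne
    have hd : (affineSpan ℝ S).direction ≠ ⊤ := by
      intro h
      rw [AffineSubspace.direction_eq_top_iff_of_nonempty ⟨y₀, subset_affineSpan ℝ S hy₀⟩] at h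
      exact hi h
    obtain ⟨ℓ, hℓ, hker⟩ := Submodule.exists_le_ker_of_lt_top _ (lt_top_iff_ne_top.2 hd)
    have hconst : ∀ y ∈ S, ℓ y = ℓ y₀ := fun y hy => by
      have := hker (AffineSubspace.vsub_mem_direction (subset_affineSpan ℝ S hy)
        (subset_affineSpan ℝ S hy₀))
      simpa [sub_eq_zero] using this
    rcases le_total (ℓ x) (ℓ y₀) with h | h
    · exact ⟨ℓ, hℓ, fun y hy => by rwa [hconst y hy]⟩
    · exact ⟨-ℓ, neg_ne_zero.2 hℓ, fun y hy => by simpa [hconst y hy] using h⟩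

section Duality

variable {U : Type*} [MeasurableSpace U] {φ : ℝ → ℝ} {μ : Measure U} {ι : Type*}

/-- The moment (in)equalities for a density: inequalities on `I`, equalities off `I`. -/
def Moments (μ : Measure U) (I : ι → Prop) (G : U → ι → ℝ) (p : ι → ℝ) (f : U → ℝ) : Prop :=
  ∀ i, (I i → ∫ u, f u * G u i ∂μ ≤ p i) ∧ (¬ I i → ∫ u, f u * G u i ∂μ = p i)

lemma Moments.sum_le [Fintype ι] {I : ι → Prop} {G : U → ι → ℝ} {p : ι → ℝ} {f : U → ℝ}
    (h : Moments μ I G p f) {lam : ι → ℝ} (hl : ∀ i, I i → 0 ≤ lam i) :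
    ∑ i, lam i * ∫ u, f u * G u i ∂μ ≤ ∑ i, lam i * p i := by
  refine Finset.sum_le_sum fun i _ => ?_
  by_cases hi : I i
  · exact mul_le_mul_of_nonneg_left ((h i).1 hi) (hl i hi)
  · rw [(h i).2 hi]

lemma exists_multipliers [Fintype ι] [IsProbabilityMeasure μ] (hΦ : PhiOne φ) {I : ι → Prop}
    {G : U → ι → ℝ} (hG : ∀ i, Heart φ μ (fun u => G u i)) {k : U → ℝ} (hk : Heart φ μ k)
    {p : ι → ℝ} {v δ : ℝ}
    (hno : ¬ ∃ f, IsDens φ μ f ∧ ∫ u, f u ∂μ = 1 ∧ Moments μ I G p f ∧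
      ∫ u, φ (f u) ∂μ ≤ δ ∧ ∫ u, f u * k u ∂μ ≤ v) :
    ∃ (r η ζ : ℝ) (lam : ι → ℝ), 0 ≤ r ∧ 0 ≤ η ∧ (∀ i, I i → 0 ≤ lam i) ∧
      ¬ (r = 0 ∧ η = 0 ∧ ζ = 0 ∧ lam = 0) ∧
      ∀ f, IsDens φ μ f → r * v + η * δ + ζ + ∑ i, lam i * p i ≤
        r * ∫ u, f u * k u ∂μ + η * ∫ u, φ (f u) ∂μ + ζ * ∫ u, f u ∂μ +
          ∑ i, lam i * ∫ u, f u * G u i ∂μ := by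
  let S : Set (ℝ × ℝ × ℝ × (ι → ℝ)) := {x | ∃ f, IsDens φ μ f ∧ ∫ u, f u ∂μ = x.2.2.1 ∧
    Moments μ I G x.2.2.2 f ∧ ∫ u, φ (f u) ∂μ ≤ x.2.1 ∧ ∫ u, f u * k u ∂μ ≤ x.1}
  have hmem : ∀ f, IsDens φ μ f → ∀ a ≥ 0, ∀ b ≥ 0, ∀ z : ι → ℝ, (∀ i, 0 ≤ z i) →
      (∀ i, ¬ I i → z i = 0) →
      ((∫ u, f u * k u ∂μ) + a, (∫ u, φ (f u) ∂μ) + b, ∫ u, f u ∂μ,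
        (fun i => ∫ u, f u * G u i ∂μ) + z) ∈ S := by
    intro f hf a ha b hb z hz hz'
    refine ⟨f, hf, rfl, fun i => ⟨fun _ => ?_, fun hi => ?_⟩, ?_, ?_⟩
    · simpa using hz i
    · simp [hz' i hi]
    · simpa using hb
    · simpa using ha
  have hconv : Convex ℝ S := by
    rintro ⟨a₁, b₁, n₁, z₁⟩ ⟨f₁, hf₁, hn₁, hz₁, hb₁, ha₁⟩ ⟨a₂, b₂, n₂, z₂⟩
      ⟨f₂, hf₂, hn₂, hz₂, hb₂, ha₂⟩ s t hs ht hst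
    obtain ⟨hd, hle⟩ := hf₁.convex_comb hΦ hf₂ hs ht hst
    refine ⟨_, hd, ?_, fun i => ⟨fun hi => ?_, fun hi => ?_⟩, ?_, ?_⟩
    · have := hf₁.integral_comb_mul hΦ hf₂ (heart_const 1) s t
      simp only [mul_one] at this
      simp only at hn₁ hn₂
      simp [this, hn₁, hn₂]
    · rw [hf₁.integral_comb_mul hΦ hf₂ (hG i)]
      exact add_le_add (mul_le_mul_of_nonneg_left ((hz₁ i).1 hi) hs)
        (mul_le_mul_of_nonneg_left ((hz₂ i).1 hi) ht)
    · rw [hf₁.integral_comb_mul hΦ hf₂ (hG i), (hz₁ i).2 hi, (hz₂ i).2 hi]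
      simp
    · exact hle.trans (add_le_add (mul_le_mul_of_nonneg_left hb₁ hs)
        (mul_le_mul_of_nonneg_left hb₂ ht))
    · rw [hf₁.integral_comb_mul hΦ hf₂ hk]
      exact add_le_add (mul_le_mul_of_nonneg_left ha₁ hs) (mul_le_mul_of_nonneg_left ha₂ ht)
  have h1 : IsDens φ μ (fun _ => (1 : ℝ)) := IsDens.const zero_le_one
  have hne : S.Nonempty := ⟨_, hmem _ h1 0 le_rfl 0 le_rfl 0 (fun _ => le_rfl) (fun _ _ => rfl)⟩
  have hx : ((v, δ, 1, p) : ℝ × ℝ × ℝ × (ι → ℝ)) ∉ S := hno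
  obtain ⟨ℓ, hℓ, hsep⟩ := exists_ne_zero_le_of_notMem_convex hconv hne hx
  set r := ℓ (1, 0, 0, 0) with hr
  set η := ℓ (0, 1, 0, 0) with hη
  set ζ := ℓ (0, 0, 1, 0) with hζ
  set lam : ι → ℝ := fun i => ℓ (0, 0, 0, Pi.single i 1) with hlam
  have hrep : ∀ a b n z, ℓ (a, b, n, z) = r * a + η * b + ζ * n + ∑ i, lam i * z i := by
    intro a b n z
    have e : ((a, b, n, z) : ℝ × ℝ × ℝ × (ι → ℝ)) = a • (1, 0, 0, 0) + b • (0, 1, 0, 0) +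
        n • (0, 0, 1, 0) + ∑ i, z i • (0, 0, 0, Pi.single i 1) := by
      ext j
      · simp [Prod.fst_sum]
      · simp [Prod.fst_sum, Prod.snd_sum]
      · simp [Prod.fst_sum, Prod.snd_sum]
      · simp [Prod.snd_sum, Finset.sum_apply, Pi.single_apply]
    rw [e]
    simp only [map_add, map_sum, map_smul, smul_eq_mul]
    simp only [← hr, ← hη, ← hζ, hlam, mul_comm]
  have key : ∀ f, IsDens φ μ f → ∀ a ≥ 0, ∀ b ≥ 0, ∀ z : ι → ℝ, (∀ i, 0 ≤ z i) →
      (∀ i, ¬ I i → z i = 0) →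
      r * v + η * δ + ζ * 1 + ∑ i, lam i * p i ≤
        r * ((∫ u, f u * k u ∂μ) + a) + η * ((∫ u, φ (f u) ∂μ) + b) + ζ * ∫ u, f u ∂μ +
          ∑ i, lam i * ((∫ u, f u * G u i ∂μ) + z i) := by
    intro f hf a ha b hb z hz hz'
    have := hsep _ (hmem f hf a ha b hb z hz hz')
    rw [hrep, hrep] at this
    simpa using this
  have hpos : ∀ c A B : ℝ, (∀ t : ℝ, 0 ≤ t → A ≤ B + c * t) → 0 ≤ c := by
    intro c A B h
    by_contra hc
    rw [not_le] at hc
    have h2 := h ((|A| + |B| + 1) / -c) (by have := neg_pos.2 hc; positivity)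
    have h3 : c * ((|A| + |B| + 1) / -c) = -(|A| + |B| + 1) := by
      have := hc.ne
      field_simp
    rw [h3] at h2
    linarith [neg_abs_le A, le_abs_self B]
  let B : ℝ := r * ∫ u, 1 * k u ∂μ + η * ∫ _, φ 1 ∂μ + ζ * ∫ _, 1 ∂μ +
    ∑ i, lam i * ∫ u, 1 * G u i ∂μ
  refine ⟨r, η, ζ, lam, ?_, ?_, ?_, ?_, ?_⟩
  · refine hpos r _ B fun t ht => (key _ h1 t ht 0 le_rfl 0 (fun _ => le_rfl)
      (fun _ _ => rfl)).trans (le_of_eq ?_)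
    simp only [B, mul_add, Pi.zero_apply, add_zero]
    ring
  · refine hpos η _ B fun t ht => (key _ h1 0 le_rfl t ht 0 (fun _ => le_rfl)
      (fun _ _ => rfl)).trans (le_of_eq ?_)
    simp only [B, mul_add, Pi.zero_apply, add_zero]
    ring
  · intro i hi
    refine hpos (lam i) _ B fun t ht => (key _ h1 0 le_rfl 0 le_rfl (Pi.single i t) (fun j => ?_)
      (fun j hj => ?_)).trans (le_of_eq ?_)
    · by_cases hij : j = i
      · subst hij; simpa using ht
      · simp [hij]
    · have : j ≠ i := fun h => hj (h ▸ hi)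
      simp [this]
    · have : ∑ j, lam j * (Pi.single i t : ι → ℝ) j = lam i * t := by
        simp [Pi.single_apply]
      simp only [B, mul_add, Finset.sum_add_distrib, this]
      ring
  · rintro ⟨h1, h2, h3, h4⟩
    refine hℓ (LinearMap.ext fun ⟨a, b, n, z⟩ => ?_)
    rw [hrep, h1, h2, h3, h4]
    simp
  · intro f hf
    simpa using key f hf 0 le_rfl 0 le_rfl 0 (fun _ => le_rfl) (fun _ _ => rfl)

end Duality
end CFSens

namespace CFSens

section Interchange

variable {U : Type*} {φ : ℝ → ℝ}

/-- A selector of the maximal value of `v u (t i)` among `i ≤ n`. -/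
def argmaxSel (v : U → ℝ → ℝ) (t : ℕ → ℝ) : ℕ → U → ℝ
  | 0, _ => t 0
  | n + 1, u => if v u (argmaxSel v t n u) ≤ v u (t (n + 1)) then t (n + 1) else argmaxSel v t n u

lemma argmaxSel_mono (v : U → ℝ → ℝ) (t : ℕ → ℝ) (u : U) :
    Monotone fun n => v u (argmaxSel v t n u) := by
  refine monotone_nat_of_le_succ fun n => ?_
  simp only [argmaxSel]
  split_ifs with h
  · exact h
  · exact le_rfl

lemma le_argmaxSel (v : U → ℝ → ℝ) (t : ℕ → ℝ) (u : U) (n : ℕ) :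
    v u (t n) ≤ v u (argmaxSel v t n u) := by
  cases n with
  | zero => exact le_rfl
  | succ n =>
    simp only [argmaxSel]
    split_ifs with h
    · exact le_rfl
    · exact (not_le.1 h).le

lemma argmaxSel_mem (v : U → ℝ → ℝ) (t : ℕ → ℝ) (n : ℕ) (u : U) :
    ∃ j ≤ n, argmaxSel v t n u = t j := by
  induction n with
  | zero => exact ⟨0, le_rfl, rfl⟩
  | succ n ih =>
    simp only [argmaxSel]
    split_ifs with h
    · exact ⟨n + 1, le_rfl, rfl⟩
    · obtain ⟨j, hj, e⟩ := ih
      exact ⟨j, by omega, e⟩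

variable [MeasurableSpace U] {μ : Measure U}

/-- A countable set of nonnegative reals along which the conjugate can be computed. -/
lemma PhiOne.exists_seq_approx (hΦ : PhiOne φ) : ∃ t : ℕ → ℝ, (∀ n, 0 ≤ t n) ∧
    ∀ η x s : ℝ, 0 ≤ s → ∀ c < s * x - η * φ s, ∃ n, c < t n * x - η * φ (t n) := by
  have hc : (((↑) : ℚ → ℝ) '' {q : ℚ | 0 ≤ q}).Countable := (to_countable _).image _
  obtain ⟨t, ht⟩ := hc.exists_eq_range ⟨0, 0, by simp⟩
  have hmem : ∀ q : ℚ, 0 ≤ q → ∃ n, t n = q := fun q hq => by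
    have : (q : ℝ) ∈ range t := ht ▸ ⟨q, hq, rfl⟩
    exact this
  refine ⟨t, fun n => ?_, fun η x s hs c hcs => ?_⟩
  · have : t n ∈ ((↑) : ℚ → ℝ) '' {q : ℚ | 0 ≤ q} := ht ▸ mem_range_self n
    obtain ⟨q, hq, e⟩ := this
    rw [← e]
    exact_mod_cast hq
  · rcases hs.eq_or_lt with h0 | h0
    · obtain ⟨n, hn⟩ := hmem 0 le_rfl
      refine ⟨n, ?_⟩
      rw [hn, Rat.cast_zero, h0]
      exact hcs
    · have hcont : ContinuousAt (fun s => s * x - η * φ s) s :=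
        (continuousAt_id.mul continuousAt_const).sub (continuousAt_const.mul
          (hΦ.continuousOn.continuousAt (Ioi_mem_nhds h0)))
      have h1 := (hcont.eventually_const_lt hcs).and (eventually_gt_nhds h0)
      obtain ⟨V, hV, hVo, hsV⟩ := eventually_nhds_iff.1 h1
      obtain ⟨q, hq⟩ := Rat.denseRange_cast.exists_mem_open hVo ⟨s, hsV⟩
      obtain ⟨n, hn⟩ := hmem q (by exact_mod_cast (hV q hq).2.le)
      exact ⟨n, by rw [hn]; exact (hV q hq).1⟩

/-- Interchange of infimum over densities and integration. -/
lemma exists_integrable_etaPhiStar [IsProbabilityMeasure μ] (hΦ : PhiOne φ) {η m : ℝ}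
    {h : U → ℝ} (hm : Measurable h) (hi : Integrable h μ)
    (hle : ∀ f, IsDens φ μ f → m ≤ η * ∫ u, φ (f u) ∂μ + ∫ u, f u * h u ∂μ) :
    ∃ w : U → ℝ, Integrable w μ ∧ (∀ᵐ u ∂μ, (w u : EReal) = etaPhiStar φ η (-h u)) ∧
      m ≤ -∫ u, w u ∂μ := by
  obtain ⟨t, ht0, ht⟩ := hΦ.exists_seq_approx
  let v : U → ℝ → ℝ := fun u s => s * (-h u) - η * φ s
  let f := argmaxSel v t
  have hfmem : ∀ n u, ∃ j ≤ n, f n u = t j := argmaxSel_mem v t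
  have hf0 : ∀ n u, 0 ≤ f n u := fun n u => by
    obtain ⟨j, -, e⟩ := hfmem n u
    rw [e]
    exact ht0 j
  have hfm : ∀ n, Measurable (f n) := by
    intro n
    induction n with
    | zero => exact measurable_const
    | succ n ih =>
      refine Measurable.ite (measurableSet_le ?_ ?_) measurable_const ih
      · exact (ih.mul hm.neg).sub ((hΦ.measurable_comp ih (hf0 n)).const_mul η)
      · exact (measurable_const.mul hm.neg).sub measurable_const
  have hdens : ∀ n, IsDens φ μ (f n) := by
    intro n
    refine ⟨hfm n, hf0 n, ?_⟩
    refine (integrable_const (∑ j ∈ Finset.range (n + 1), φ (t j))).mono'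
      (hΦ.measurable_comp (hfm n) (hf0 n)).aestronglyMeasurable (Eventually.of_forall fun u => ?_)
    rw [Real.norm_of_nonneg (hΦ.nonneg (hf0 n u))]
    obtain ⟨j, hj, e⟩ := hfmem n u
    rw [e]
    exact Finset.single_le_sum (f := fun j => φ (t j)) (fun j _ => hΦ.nonneg (ht0 j))
      (Finset.mem_range.2 (by omega))
  have hmul : ∀ n, Integrable (fun u => f n u * h u) μ := by
    intro n
    refine (hi.norm.const_mul (∑ j ∈ Finset.range (n + 1), t j)).mono'
      ((hfm n).mul hm).aestronglyMeasurable (Eventually.of_forall fun u => ?_)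
    rw [norm_mul, Real.norm_of_nonneg (hf0 n u)]
    refine mul_le_mul_of_nonneg_right ?_ (norm_nonneg _)
    obtain ⟨j, hj, e⟩ := hfmem n u
    rw [e]
    exact Finset.single_le_sum (f := fun j => t j) (fun j _ => ht0 j)
      (Finset.mem_range.2 (by omega))
  let V : ℕ → U → ℝ := fun n u => v u (f n u)
  have hVdef : ∀ n u, V n u = -(η * φ (f n u) + f n u * h u) := fun n u => by
    simp only [V, v]; ring
  have hVi : ∀ n, Integrable (V n) μ := by
    intro n
    simp only [funext (hVdef n)]
    exact (((hdens n).int.const_mul η).add (hmul n)).neg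
  have hVm : ∀ n, Measurable (V n) := fun n => by
    simp only [funext (hVdef n)]
    exact (((hΦ.measurable_comp (hfm n) (hf0 n)).const_mul η).add ((hfm n).mul hm)).neg
  have hVint : ∀ n, ∫ u, V n u ∂μ ≤ -m := by
    intro n
    simp only [hVdef]
    rw [integral_neg, integral_add ((hdens n).int.const_mul η) (hmul n), integral_const_mul]
    linarith [hle _ (hdens n)]
  have hVmono : ∀ u, Monotone fun n => V n u := fun u => argmaxSel_mono v t u
  have hmeas : ∀ n, Measurable (fun u => ENNReal.ofReal (V n u - V 0 u)) :=
    fun n => ((hVm n).sub (hVm 0)).ennreal_ofReal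
  have hlint : ∫⁻ u, ⨆ n, ENNReal.ofReal (V n u - V 0 u) ∂μ ≤
      ENNReal.ofReal (-m - ∫ u, V 0 u ∂μ) := by
    rw [lintegral_iSup hmeas
      (fun i j hij u => ENNReal.ofReal_le_ofReal (sub_le_sub_right (hVmono u hij) _))]
    refine iSup_le fun n => ?_
    have hsub : Integrable (fun u => V n u - V 0 u) μ := (hVi n).sub (hVi 0)
    rw [← ofReal_integral_eq_lintegral_ofReal hsub
      (Eventually.of_forall fun u => sub_nonneg.2 (hVmono u (Nat.zero_le n))),
      integral_sub (hVi n) (hVi 0)]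
    exact ENNReal.ofReal_le_ofReal (sub_le_sub_right (hVint n) _)
  have hbdd : ∀ᵐ u ∂μ, BddAbove (range fun n => V n u) := by
    have h1 := ae_lt_top (Measurable.iSup hmeas)
      (ne_top_of_le_ne_top ENNReal.ofReal_ne_top hlint)
    filter_upwards [h1] with u hu
    refine ⟨(⨆ n, ENNReal.ofReal (V n u - V 0 u)).toReal + V 0 u, ?_⟩
    rintro _ ⟨n, rfl⟩
    have h2 : ENNReal.ofReal (V n u - V 0 u) ≤ ⨆ n, ENNReal.ofReal (V n u - V 0 u) :=
      le_iSup (fun n => ENNReal.ofReal (V n u - V 0 u)) n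
    have h3 := (ENNReal.ofReal_le_iff_le_toReal hu.ne).1 h2
    simp only
    linarith
  let W : U → ℝ := fun u => ⨆ n, V n u
  have hWt : ∀ᵐ u ∂μ, Tendsto (fun n => V n u) atTop (nhds (W u)) := by
    filter_upwards [hbdd] with u hu
    exact tendsto_atTop_ciSup (hVmono u) hu
  have hWm : AEStronglyMeasurable W μ :=
    aestronglyMeasurable_of_tendsto_ae atTop (fun n => (hVm n).aestronglyMeasurable) hWt
  have hWi : Integrable W μ := by
    have h1 : Integrable (fun u => W u - V 0 u) μ := by
      refine ⟨hWm.sub (hVm 0).aestronglyMeasurable, ?_⟩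
      rw [hasFiniteIntegral_iff_ofReal]
      · refine lt_of_le_of_lt (lintegral_mono_ae ?_) (hlint.trans_lt ENNReal.ofReal_lt_top)
        filter_upwards [hWt] with u hu
        refine le_of_tendsto' (ENNReal.tendsto_ofReal (hu.sub_const (V 0 u))) fun n => ?_
        exact le_iSup (fun n => ENNReal.ofReal (V n u - V 0 u)) n
      · filter_upwards [hbdd] with u hu
        exact sub_nonneg.2 (le_ciSup hu 0)
    exact (h1.add (hVi 0)).congr (Eventually.of_forall fun u => sub_add_cancel (W u) (V 0 u))
  refine ⟨W, hWi, ?_, ?_⟩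
  · filter_upwards [hbdd, hWt] with u hu hut
    apply le_antisymm
    · refine le_of_tendsto' ((continuous_coe_real_ereal.tendsto _).comp hut) fun n => ?_
      exact le_iSup₂_of_le (f := fun (s : ℝ) (_ : s ∈ Ici (0:ℝ)) =>
        ((s * (-h u) - η * φ s : ℝ) : EReal)) (f n u) (hf0 n u) le_rfl
    · refine iSup₂_le fun s hs => ?_
      have : s * (-h u) - η * φ s ≤ W u := by
        refine le_of_forall_lt fun c hc => ?_
        obtain ⟨n, hn⟩ := ht η (-h u) s hs c hc
        exact hn.trans_le ((le_argmaxSel v t u n).trans (le_ciSup hu n))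
      exact_mod_cast this
  · have h1 := integral_tendsto_of_tendsto_of_monotone hVi hWi (Eventually.of_forall hVmono) hWt
    have h2 := le_of_tendsto' h1 hVint
    linarith

end Interchange
end CFSens

namespace CFSens

section DensityDuality

variable {U : Type*} [MeasurableSpace U] {φ : ℝ → ℝ} {μ : Measure U} [IsProbabilityMeasure μ]
  {ι : Type*} [Fintype ι] {I : ι → Prop} {G : U → ι → ℝ} {k : U → ℝ} {p : ι → ℝ}

lemma IsDens.integral_mul_affine (hΦ : PhiOne φ) {f : U → ℝ} (hf : IsDens φ μ f)
    (hG : ∀ i, Heart φ μ (fun u => G u i)) (hk : Heart φ μ k) (ζ : ℝ) (lam : ι → ℝ) :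
    Integrable (fun u => f u * (k u + ζ + ∑ i, lam i * G u i)) μ ∧
    ∫ u, f u * (k u + ζ + ∑ i, lam i * G u i) ∂μ =
      ∫ u, f u * k u ∂μ + ζ * ∫ u, f u ∂μ + ∑ i, lam i * ∫ u, f u * G u i ∂μ := by
  have e : (fun u => f u * (k u + ζ + ∑ i, lam i * G u i)) =
      fun u => f u * k u + ζ * f u + ∑ i, lam i * (f u * G u i) := by
    funext u
    rw [mul_add, mul_add, Finset.mul_sum, mul_comm (f u) ζ]
    congr 1
    exact Finset.sum_congr rfl fun i _ => by ring
  have h1 := hf.integrable_mul hΦ hk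
  have h2 := (hf.integrable hΦ).const_mul ζ
  have h3 : ∀ i ∈ Finset.univ, Integrable (fun u => lam i * (f u * G u i)) μ :=
    fun i _ => (hf.integrable_mul hΦ (hG i)).const_mul (lam i)
  have h12 : Integrable (fun u => f u * k u + ζ * f u) μ := h1.add h2
  rw [e]
  refine ⟨h12.add (integrable_finsetSum _ h3), ?_⟩
  rw [integral_add h12 (integrable_finsetSum _ h3), integral_add h1 h2,
    integral_finsetSum _ h3, integral_const_mul]
  simp only [integral_const_mul]

/-- Weak duality. -/
lemma IsDens.dual_le (hΦ : PhiOne φ) {f : U → ℝ} (hf : IsDens φ μ f)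
    (hG : ∀ i, Heart φ μ (fun u => G u i)) (hk : Heart φ μ k) {η ζ : ℝ} {lam : ι → ℝ}
    {w : U → ℝ} (hw : Integrable w μ)
    (hwe : ∀ᵐ u ∂μ, (w u : EReal) = etaPhiStar φ η (-k u - ζ - ∑ i, lam i * G u i)) :
    -(∫ u, w u ∂μ) - ζ * ∫ u, f u ∂μ - ∑ i, lam i * ∫ u, f u * G u i ∂μ ≤
      η * ∫ u, φ (f u) ∂μ + ∫ u, f u * k u ∂μ := by
  obtain ⟨hi, he⟩ := hf.integral_mul_affine hΦ hG hk ζ lam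
  have h1 : -∫ u, w u ∂μ ≤
      η * ∫ u, φ (f u) ∂μ + ∫ u, f u * (k u + ζ + ∑ i, lam i * G u i) ∂μ := by
    rw [← integral_neg, ← integral_const_mul, ← integral_add (hf.int.const_mul η) hi]
    refine integral_mono_ae hw.neg ((hf.int.const_mul η).add hi) ?_
    filter_upwards [hwe] with u hu
    have h2 : ((f u * (-k u - ζ - ∑ i, lam i * G u i) - η * φ (f u) : ℝ) : EReal) ≤ (w u : EReal) := by
      rw [hu]
      exact le_iSup₂_of_le (f := fun (s : ℝ) (_ : s ∈ Ici (0:ℝ)) =>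
        ((s * (-k u - ζ - ∑ i, lam i * G u i) - η * φ s : ℝ) : EReal)) (f u) (hf.nonneg u) le_rfl
    have h3 := EReal.coe_le_coe_iff.1 h2
    have h4 : f u * (-k u - ζ - ∑ i, lam i * G u i) = -(f u * (k u + ζ + ∑ i, lam i * G u i)) := by
      ring
    linarith
  linarith

/-- Nontrivial multipliers cannot vanish on the cost coordinates. -/
lemma multipliers_eq_zero
    (hS : ∀ lam : ι → ℝ, (∀ i, I i → 0 ≤ lam i) → (∀ f, IsDens φ μ f → ∫ u, f u ∂μ = 1 →
      ∑ i, lam i * p i ≤ ∑ i, lam i * ∫ u, f u * G u i ∂μ) → lam = 0)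
    {r ζ : ℝ} {lam : ι → ℝ} (hr : 0 ≤ r) (hl : ∀ i, I i → 0 ≤ lam i)
    (h : ∀ f, IsDens φ μ f → r + ζ + ∑ i, lam i * p i ≤
      ζ * ∫ u, f u ∂μ + ∑ i, lam i * ∫ u, f u * G u i ∂μ) :
    r = 0 ∧ ζ = 0 ∧ lam = 0 := by
  have h0 : lam = 0 := hS lam hl fun f hf hf1 => by
    have := h f hf
    rw [hf1] at this
    linarith
  subst h0
  have a := h _ (IsDens.const (φ := φ) (μ := μ) le_rfl)
  have b := h _ (IsDens.const (φ := φ) (μ := μ) zero_le_two)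
  simp at a b
  exact ⟨by linarith, by linarith, rfl⟩

/-- A strict upper bound on the dual of the minimum-divergence problem is attained by a feasible
density. -/
lemma exists_density_of_dual_lt (hΦ : PhiOne φ) (hG : ∀ i, Heart φ μ (fun u => G u i))
    (hS : ∀ lam : ι → ℝ, (∀ i, I i → 0 ≤ lam i) → (∀ f, IsDens φ μ f → ∫ u, f u ∂μ = 1 →
      ∑ i, lam i * p i ≤ ∑ i, lam i * ∫ u, f u * G u i ∂μ) → lam = 0) {δ : ℝ}
    (hlt : ∀ (ζ : ℝ) (lam : ι → ℝ) (w : U → ℝ), (∀ i, I i → 0 ≤ lam i) → Integrable w μ →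
      (∀ᵐ u ∂μ, (w u : EReal) = phiStar φ (-ζ - ∑ i, lam i * G u i)) →
      -(∫ u, w u ∂μ) - ζ - ∑ i, lam i * p i < δ) :
    ∃ f, IsDens φ μ f ∧ ∫ u, f u ∂μ = 1 ∧ Moments μ I G p f ∧ ∫ u, φ (f u) ∂μ ≤ δ := by
  by_contra hno
  have hk0 : Heart φ μ (fun _ => (0:ℝ)) := heart_const 0
  obtain ⟨r, η, ζ, lam, hr, hη, hl, hnz, hle⟩ := exists_multipliers (δ := δ) (v := 1) hΦ hG hk0
    (fun ⟨f, h1, h2, h3, h4, _⟩ => hno ⟨f, h1, h2, h3, h4⟩)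
  simp only [mul_zero, integral_zero, zero_add, mul_one] at hle
  rcases hη.eq_or_lt with h0 | hη
  · subst h0
    obtain ⟨a, b, c⟩ := multipliers_eq_zero hS (r := r) (ζ := ζ) hr hl fun f hf => by
      have := hle f hf
      linarith
    exact hnz ⟨a, rfl, b, c⟩
  · let lam' : ι → ℝ := fun i => lam i / η
    have hsum : ∀ x : ι → ℝ, ∑ i, lam' i * x i = (∑ i, lam i * x i) / η := fun x => by
      rw [Finset.sum_div]
      exact Finset.sum_congr rfl fun i _ => by simp only [lam']; ring
    have hm : Measurable fun u => (0:ℝ) + ζ / η + ∑ i, lam' i * G u i :=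
      measurable_const.add (Finset.measurable_fun_sum _ fun i _ => (hG i).1.const_mul (lam' i))
    have hi : Integrable (fun u => (0:ℝ) + ζ / η + ∑ i, lam' i * G u i) μ :=
      (integrable_const _).add (integrable_finsetSum _ fun i _ =>
        ((hG i).integrable hΦ).const_mul (lam' i))
    obtain ⟨w, hw, hwe, hwm⟩ := exists_integrable_etaPhiStar (η := 1)
      (m := δ + ζ / η + ∑ i, lam' i * p i) hΦ hm hi fun f hf => by
        rw [(hf.integral_mul_affine hΦ hG hk0 (ζ / η) lam').2, hsum, hsum]
        have := hle f hf
        simp only [mul_zero, integral_zero, zero_add]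
        have e : δ + ζ / η + (∑ i, lam i * p i) / η = (η * δ + ζ + ∑ i, lam i * p i) / η := by
          field_simp
        have e' : 1 * (∫ u, φ (f u) ∂μ) + (ζ / η * ∫ u, f u ∂μ +
            (∑ i, lam i * ∫ u, f u * G u i ∂μ) / η) =
            (η * (∫ u, φ (f u) ∂μ) + ζ * (∫ u, f u ∂μ) + ∑ i, lam i * ∫ u, f u * G u i ∂μ) / η := by
          field_simp
          ring
        rw [e, e']
        exact div_le_div_of_nonneg_right (by linarith) hη.le
    have := hlt (ζ / η) lam' w (fun i hi => div_nonneg (hl i hi) hη.le) hw (by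
      filter_upwards [hwe] with u hu
      rw [hu, etaPhiStar_one]
      congr 1
      ring)
    linarith

/-- Strong duality under a Slater point. -/
lemma exists_dual_ge (hΦ : PhiOne φ) (hG : ∀ i, Heart φ μ (fun u => G u i))
    (hk : Heart φ μ k)
    (hS : ∀ lam : ι → ℝ, (∀ i, I i → 0 ≤ lam i) → (∀ f, IsDens φ μ f → ∫ u, f u ∂μ = 1 →
      ∑ i, lam i * p i ≤ ∑ i, lam i * ∫ u, f u * G u i ∂μ) → lam = 0) {δ v : ℝ}
    {f₀ : U → ℝ} (hf₀ : IsDens φ μ f₀) (hf₀1 : ∫ u, f₀ u ∂μ = 1) (hf₀m : Moments μ I G p f₀)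
    (hf₀δ : ∫ u, φ (f₀ u) ∂μ < δ)
    (hno : ¬ ∃ f, IsDens φ μ f ∧ ∫ u, f u ∂μ = 1 ∧ Moments μ I G p f ∧
      ∫ u, φ (f u) ∂μ ≤ δ ∧ ∫ u, f u * k u ∂μ ≤ v) :
    ∃ (η ζ : ℝ) (lam : ι → ℝ) (w : U → ℝ), 0 ≤ η ∧ (∀ i, I i → 0 ≤ lam i) ∧ Integrable w μ ∧
      (∀ᵐ u ∂μ, (w u : EReal) = etaPhiStar φ η (-k u - ζ - ∑ i, lam i * G u i)) ∧
      v ≤ -(∫ u, w u ∂μ) - η * δ - ζ - ∑ i, lam i * p i := by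
  obtain ⟨r, η, ζ, lam, hr, hη, hl, hnz, hle⟩ := exists_multipliers hΦ hG hk hno
  rcases hr.eq_or_lt with h0 | hr
  · exfalso
    subst h0
    have h1 := hle f₀ hf₀
    have h2 := hf₀m.sum_le hl
    have h3 : η = 0 := by
      refine le_antisymm ?_ hη
      rw [hf₀1] at h1
      by_contra hη'
      rw [not_le] at hη'
      have := mul_lt_mul_of_pos_left hf₀δ hη'
      linarith
    subst h3
    obtain ⟨-, b, c⟩ := multipliers_eq_zero hS (r := 0) (ζ := ζ) le_rfl hl fun f hf => by
      have := hle f hf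
      linarith
    exact hnz ⟨rfl, rfl, b, c⟩
  · let lam' : ι → ℝ := fun i => lam i / r
    have hsum : ∀ x : ι → ℝ, ∑ i, lam' i * x i = (∑ i, lam i * x i) / r := fun x => by
      rw [Finset.sum_div]
      exact Finset.sum_congr rfl fun i _ => by simp only [lam']; ring
    have hm : Measurable fun u => k u + ζ / r + ∑ i, lam' i * G u i :=
      (hk.1.add measurable_const).add
        (Finset.measurable_fun_sum _ fun i _ => (hG i).1.const_mul (lam' i))
    have hi : Integrable (fun u => k u + ζ / r + ∑ i, lam' i * G u i) μ :=
      ((hk.integrable hΦ).add (integrable_const _)).add (integrable_finsetSum _ fun i _ =>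
        ((hG i).integrable hΦ).const_mul (lam' i))
    obtain ⟨w, hw, hwe, hwm⟩ := exists_integrable_etaPhiStar (η := η / r)
      (m := v + η / r * δ + ζ / r + ∑ i, lam' i * p i) hΦ hm hi fun f hf => by
        rw [(hf.integral_mul_affine hΦ hG hk (ζ / r) lam').2, hsum, hsum]
        have := hle f hf
        have e : v + η / r * δ + ζ / r + (∑ i, lam i * p i) / r =
            (r * v + η * δ + ζ + ∑ i, lam i * p i) / r := by
          field_simp
        have e' : η / r * (∫ u, φ (f u) ∂μ) + (∫ u, f u * k u ∂μ + ζ / r * ∫ u, f u ∂μ +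
            (∑ i, lam i * ∫ u, f u * G u i ∂μ) / r) =
            (r * (∫ u, f u * k u ∂μ) + η * (∫ u, φ (f u) ∂μ) + ζ * (∫ u, f u ∂μ) +
              ∑ i, lam i * ∫ u, f u * G u i ∂μ) / r := by
          field_simp
          ring
        rw [e, e']
        exact div_le_div_of_nonneg_right this hr.le
    refine ⟨η / r, ζ / r, lam', w, by positivity, fun i hi => div_nonneg (hl i hi) hr.le, hw, ?_,
      by linarith⟩
    filter_upwards [hwe] with u hu
    rw [hu]
    congr 1
    ring

end DensityDuality
end CFSens

namespace CFSens

/-! ### Stacked vectors as functions on a single index type -/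

section Flatten

variable {d1 d2 d3 d4 : ℕ}

/-- Index type of the stacked moments. -/
abbrev MomentIdx (d1 d2 d3 d4 : ℕ) := Fin d1 ⊕ Fin d2 ⊕ Fin d3 ⊕ Fin d4

/-- A stacked vector as a function on `MomentIdx`. -/
def flat (v : Vec4 d1 d2 d3 d4) : MomentIdx d1 d2 d3 d4 → ℝ :=
  Sum.elim v.1 (Sum.elim v.2.1 (Sum.elim v.2.2.1 v.2.2.2))

/-- The inverse of `flat`. -/
def unflat (x : MomentIdx d1 d2 d3 d4 → ℝ) : Vec4 d1 d2 d3 d4 :=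
  (fun i => x (.inl i), fun i => x (.inr (.inl i)), fun i => x (.inr (.inr (.inl i))),
    fun i => x (.inr (.inr (.inr i))))

/-- The indices of the inequality constraints. -/
def IsIneq : MomentIdx d1 d2 d3 d4 → Prop :=
  Sum.elim (fun _ => True) (Sum.elim (fun _ => False) (Sum.elim (fun _ => True) fun _ => False))

/-- The right-hand sides of the constraints. -/
def target (P : Vec12 d1 d2) : Vec4 d1 d2 d3 d4 := (P.1, P.2, 0, 0)

@[simp] lemma flat_unflat (x : MomentIdx d1 d2 d3 d4 → ℝ) : flat (unflat x) = x := by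
  funext i
  rcases i with i | i | i | i <;> rfl

lemma flat_add (a b : Vec4 d1 d2 d3 d4) : flat (a + b) = flat a + flat b := by
  funext i
  rcases i with i | i | i | i <;> rfl

lemma flat_sub_smul (a b : Vec4 d1 d2 d3 d4) (t : ℝ) : flat (a - t • b) = flat a - t • flat b := by
  funext i
  rcases i with i | i | i | i <;> rfl

lemma dot4_eq (a b : Vec4 d1 d2 d3 d4) : dot4 a b = ∑ i, flat a i * flat b i := by
  simp only [dot4, dot, Fintype.sum_sum_type, flat, Sum.elim_inl, Sum.elim_inr]
  ring

lemma dotP_eq (l : Vec4 d1 d2 d3 d4) (P : Vec12 d1 d2) :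
    dotP l P = ∑ i, flat l i * flat (target P : Vec4 d1 d2 d3 d4) i := by
  rw [← dot4_eq]
  simp [dot4, dotP, dot, target]

lemma inLambda_iff (l : Vec4 d1 d2 d3 d4) : inLambda l ↔ ∀ i, IsIneq i → 0 ≤ flat l i := by
  constructor
  · rintro ⟨h1, h2⟩ (i | i | i | i) hi
    · exact h1 i
    · exact hi.elim
    · exact h2 i
    · exact hi.elim
  · intro h
    exact ⟨fun i => h (.inl i) trivial, fun i => h (.inr (.inr (.inl i))) trivial⟩

end Flatten

/-! ### Probability measures and densities -/

section Measures

variable {U : Type*} [MeasurableSpace U] {φ : ℝ → ℝ} {μ : Measure U}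

/-- The measure with real density `f`. -/
def dens (μ : Measure U) (f : U → ℝ) : Measure U := μ.withDensity fun u => ENNReal.ofReal (f u)

lemma IsDens.integrable_dens_iff {f : U → ℝ} (hf : IsDens φ μ f) (h : U → ℝ) :
    Integrable h (dens μ f) ↔ Integrable (fun u => f u * h u) μ := by
  rw [dens, integrable_withDensity_iff_integrable_smul' hf.meas.ennreal_ofReal (by simp)]
  simp only [ENNReal.toReal_ofReal (hf.nonneg _), smul_eq_mul]

lemma IsDens.integral_dens {f : U → ℝ} (hf : IsDens φ μ f) (h : U → ℝ) :
    ∫ u, h u ∂(dens μ f) = ∫ u, f u * h u ∂μ := by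
  rw [dens, integral_withDensity_eq_integral_toReal_smul hf.meas.ennreal_ofReal (by simp)]
  simp only [ENNReal.toReal_ofReal (hf.nonneg _), smul_eq_mul]

variable [IsProbabilityMeasure μ]

lemma IsDens.isProbabilityMeasure_dens (hΦ : PhiOne φ) {f : U → ℝ} (hf : IsDens φ μ f)
    (h1 : ∫ u, f u ∂μ = 1) : IsProbabilityMeasure (dens μ f) := by
  refine ⟨?_⟩
  rw [dens, withDensity_apply _ MeasurableSet.univ, Measure.restrict_univ,
    ← ofReal_integral_eq_lintegral_ofReal (hf.integrable hΦ) (Eventually.of_forall hf.nonneg), h1,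
    ENNReal.ofReal_one]

lemma IsDens.Dphi_dens (hΦ : PhiOne φ) {f : U → ℝ} (hf : IsDens φ μ f) :
    Dphi φ μ (dens μ f) = ENNReal.ofReal (∫ u, φ (f u) ∂μ) := by
  rw [Dphi, if_pos (show dens μ f ≪ μ from withDensity_absolutelyContinuous _ _),
    ofReal_integral_eq_lintegral_ofReal hf.int
      (Eventually.of_forall fun u => hΦ.nonneg (hf.nonneg u))]
  refine lintegral_congr_ae ?_
  filter_upwards [Measure.rnDeriv_withDensity μ hf.meas.ennreal_ofReal] with u hu
  rw [dens, hu, ENNReal.toReal_ofReal (hf.nonneg u)]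

lemma exists_isDens_of_Dphi_lt_top (hΦ : PhiOne φ) {F : Measure U} [IsProbabilityMeasure F]
    (hF : Dphi φ μ F < ⊤) : ∃ f, IsDens φ μ f ∧ ∫ u, f u ∂μ = 1 ∧ F = dens μ f := by
  have hac : F ≪ μ := by
    by_contra h
    simp [Dphi, h] at hF
  rw [Dphi, if_pos hac] at hF
  have hm : Measurable fun u => (F.rnDeriv μ u).toReal := (F.measurable_rnDeriv μ).ennreal_toReal
  have hd : IsDens φ μ fun u => (F.rnDeriv μ u).toReal := by
    refine ⟨hm, fun u => ENNReal.toReal_nonneg,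
      (hΦ.measurable_comp hm fun u => ENNReal.toReal_nonneg).aestronglyMeasurable, ?_⟩
    rwa [hasFiniteIntegral_iff_ofReal
      (Eventually.of_forall fun u => hΦ.nonneg ENNReal.toReal_nonneg)]
  have he : F = dens μ fun u => (F.rnDeriv μ u).toReal := by
    conv_lhs => rw [← Measure.withDensity_rnDeriv_eq F μ hac]
    refine withDensity_congr_ae ?_
    filter_upwards [F.rnDeriv_lt_top μ] with u hu
    rw [ENNReal.ofReal_toReal hu.ne]
  refine ⟨_, hd, ?_, he⟩
  have := hd.integral_dens (fun _ => 1)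
  rw [← he] at this
  simpa using this.symm

end Measures

section Translate

variable {U : Type*} [MeasurableSpace U] {φ : ℝ → ℝ} {μ : Measure U}
  {dθ d1 d2 d3 d4 : ℕ} {Γ : Type*} {g : U → (Fin dθ → ℝ) → Γ → Vec4 d1 d2 d3 d4}
  {k : U → (Fin dθ → ℝ) → Γ → ℝ}

/-- Densities satisfying the constraints within divergence `δ`. -/
structure FeasDens (φ : ℝ → ℝ) (μ : Measure U) (g : U → (Fin dθ → ℝ) → Γ → Vec4 d1 d2 d3 d4)
    (δ : ℝ) (θ : Fin dθ → ℝ) (γ : Γ) (P : Vec12 d1 d2) (f : U → ℝ) : Prop where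
  dens : IsDens φ μ f
  one : ∫ u, f u ∂μ = 1
  moments : Moments μ IsIneq (fun u => flat (g u θ γ)) (flat (target P)) f
  le : ∫ u, φ (f u) ∂μ ≤ δ

lemma IsDens.moments_iff {f : U → ℝ} (hf : IsDens φ μ f) (θ : Fin dθ → ℝ) (γ : Γ) (P : Vec12 d1 d2) :
    Moments μ IsIneq (fun u => flat (g u θ γ)) (flat (target P)) f ↔
    (∀ i, ∫ u, (g u θ γ).1 i ∂(CFSens.dens μ f) ≤ P.1 i) ∧
    (∀ i, ∫ u, (g u θ γ).2.1 i ∂(CFSens.dens μ f) = P.2 i) ∧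
    (∀ i, ∫ u, (g u θ γ).2.2.1 i ∂(CFSens.dens μ f) ≤ 0) ∧
    (∀ i, ∫ u, (g u θ γ).2.2.2 i ∂(CFSens.dens μ f) = 0) := by
  simp only [hf.integral_dens]
  constructor
  · intro h
    exact ⟨fun i => (h (.inl i)).1 trivial, fun i => (h (.inr (.inl i))).2 not_false,
      fun i => (h (.inr (.inr (.inl i)))).1 trivial,
      fun i => (h (.inr (.inr (.inr i)))).2 not_false⟩
  · rintro ⟨h1, h2, h3, h4⟩ (i | i | i | i)
    · exact ⟨fun _ => h1 i, fun h => (h trivial).elim⟩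
    · exact ⟨fun h => h.elim, fun _ => h2 i⟩
    · exact ⟨fun _ => h3 i, fun h => (h trivial).elim⟩
    · exact ⟨fun h => h.elim, fun _ => h4 i⟩

variable [IsProbabilityMeasure μ]

lemma PhiTwo.heart_flat (hΦ : PhiOne φ) (h : PhiTwo φ μ g k) (θ : Fin dθ → ℝ) (γ : Γ)
    (i : MomentIdx d1 d2 d3 d4) : Heart φ μ (fun u => flat (g u θ γ) i) := by
  obtain ⟨-, h1, h2, h3, h4⟩ := h θ γ
  rcases i with i | i | i | i
  · exact (h1 i).heart hΦ
  · exact (h2 i).heart hΦ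
  · exact (h3 i).heart hΦ
  · exact (h4 i).heart hΦ

lemma PhiTwo.heart (hΦ : PhiOne φ) (h : PhiTwo φ μ g k) (θ : Fin dθ → ℝ) (γ : Γ) :
    Heart φ μ (fun u => k u θ γ) := (h θ γ).1.heart hΦ

lemma PhiTwo.gIntegrable (hΦ : PhiOne φ) (h : PhiTwo φ μ g k) (θ : Fin dθ → ℝ) (γ : Γ) {f : U → ℝ}
    (hf : IsDens φ μ f) : GIntegrable g θ γ (dens μ f) := by
  have key : ∀ i, Integrable (fun u => flat (g u θ γ) i) (dens μ f) := fun i =>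
    (hf.integrable_dens_iff _).2 (hf.integrable_mul hΦ (h.heart_flat hΦ θ γ i))
  exact ⟨fun i => key (.inl i), fun i => key (.inr (.inl i)), fun i => key (.inr (.inr (.inl i))),
    fun i => key (.inr (.inr (.inr i)))⟩

lemma FeasDens.feasible (hΦ : PhiOne φ) (h2 : PhiTwo φ μ g k) {δ : ℝ} {θ : Fin dθ → ℝ} {γ : Γ}
    {P : Vec12 d1 d2} {f : U → ℝ} (hf : FeasDens φ μ g δ θ γ P f) :
    Feasible φ μ g δ θ γ P (CFSens.dens μ f) := by
  refine ⟨hf.dens.isProbabilityMeasure_dens hΦ hf.one, ?_, h2.gIntegrable hΦ θ γ hf.dens,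
    (hf.dens.moments_iff θ γ P).1 hf.moments⟩
  rw [hf.dens.Dphi_dens hΦ]
  exact ENNReal.ofReal_le_ofReal hf.le

lemma Feasible.exists_feasDens (hΦ : PhiOne φ) {δ : ℝ} (hδ : 0 ≤ δ) {θ : Fin dθ → ℝ} {γ : Γ}
    {P : Vec12 d1 d2} {F : Measure U} (hF : Feasible φ μ g δ θ γ P F) :
    ∃ f, FeasDens φ μ g δ θ γ P f ∧ F = CFSens.dens μ f := by
  obtain ⟨hp, hD, -, hC⟩ := hF
  obtain ⟨f, hf, h1, rfl⟩ := exists_isDens_of_Dphi_lt_top hΦ (hD.trans_lt ENNReal.ofReal_lt_top)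
  rw [hf.Dphi_dens hΦ, ENNReal.ofReal_le_ofReal_iff hδ] at hD
  exact ⟨f, ⟨hf, h1, (hf.moments_iff θ γ P).2 hC, hD⟩, rfl⟩

lemma le_kappaLow_iff (hΦ : PhiOne φ) (h2 : PhiTwo φ μ g k) {δ : ℝ} (hδ : 0 ≤ δ)
    {θ : Fin dθ → ℝ} {γ : Γ} {P : Vec12 d1 d2} {x : EReal} :
    x ≤ kappaLow φ μ g k δ θ γ P ↔
      ∀ f, FeasDens φ μ g δ θ γ P f → x ≤ ((∫ u, f u * k u θ γ ∂μ : ℝ) : EReal) := by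
  rw [kappaLow, le_sInf_iff]
  constructor
  · intro h f hf
    refine h _ ⟨_, hf.feasible hΦ h2, ?_, ?_⟩
    · exact (hf.dens.integrable_dens_iff _).2 (hf.dens.integrable_mul hΦ (h2.heart hΦ θ γ))
    · rw [hf.dens.integral_dens]
  · rintro h _ ⟨F, hF, -, rfl⟩
    obtain ⟨f, hf, rfl⟩ := hF.exists_feasDens hΦ hδ
    rw [hf.dens.integral_dens]
    exact h f hf

lemma ConditionS.multiplier_eq_zero (hΦ : PhiOne φ) {θ : Fin dθ → ℝ} {γ : Γ} {P : Vec12 d1 d2}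
    (hS : ConditionS φ μ g θ γ P) {lam : MomentIdx d1 d2 d3 d4 → ℝ}
    (hl : ∀ i, IsIneq i → 0 ≤ lam i)
    (h : ∀ f, IsDens φ μ f → ∫ u, f u ∂μ = 1 →
      ∑ i, lam i * flat (target P : Vec4 d1 d2 d3 d4) i ≤
        ∑ i, lam i * ∫ u, f u * flat (g u θ γ) i ∂μ) : lam = 0 := by
  have h1 : ∀ y ∈ momentSet φ μ g θ γ + coneC,
      ∑ i, lam i * flat (target P : Vec4 d1 d2 d3 d4) i ≤ ∑ i, lam i * flat y i := by
    rintro _ ⟨_, ⟨F, hp, hD, -, rfl⟩, c, hc, rfl⟩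
    obtain ⟨f, hf, h1, rfl⟩ := exists_isDens_of_Dphi_lt_top hΦ hD
    refine (h f hf h1).trans (Finset.sum_le_sum fun i _ => ?_)
    simp only [flat_add, Pi.add_apply, mul_add]
    obtain ⟨c1, c2, c3, c4⟩ := hc
    rcases i with i | i | i | i
    · have := mul_nonneg (hl (.inl i) trivial) (c1 i)
      simpa [flat, hf.integral_dens] using this
    · simp [flat, hf.integral_dens, c2]
    · have := mul_nonneg (hl (.inr (.inr (.inl i))) trivial) (c3 i)
      simpa [flat, hf.integral_dens] using this
    · simp [flat, hf.integral_dens, c4]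
  have hcont : ContinuousAt (fun t : ℝ => (target P : Vec4 d1 d2 d3 d4) - t • unflat lam) 0 := by
    fun_prop
  have h2 : ∀ᶠ t : ℝ in nhds 0, (target P : Vec4 d1 d2 d3 d4) - t • unflat lam ∈
      momentSet φ μ g θ γ + coneC := by
    refine hcont.eventually_mem ?_
    rw [zero_smul, sub_zero]
    exact mem_interior_iff_mem_nhds.1 hS
  obtain ⟨t, ht, ht0⟩ := ((h2.filter_mono nhdsWithin_le_nhds).and
    (self_mem_nhdsWithin : Ioi (0:ℝ) ∈ nhdsWithin 0 (Ioi 0))).exists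
  have h3 := h1 _ ht
  rw [flat_sub_smul, flat_unflat] at h3
  have h4 : ∑ i, lam i * (flat (target P : Vec4 d1 d2 d3 d4) - t • lam) i =
      ∑ i, lam i * flat (target P : Vec4 d1 d2 d3 d4) i - t * ∑ i, lam i * lam i := by
    rw [Finset.mul_sum, ← Finset.sum_sub_distrib]
    refine Finset.sum_congr rfl fun i _ => ?_
    simp only [Pi.sub_apply, Pi.smul_apply, smul_eq_mul]
    ring
  have h5 : ∑ i, lam i * lam i ≤ 0 := by
    rw [h4] at h3
    by_contra hc
    have := mul_pos (show 0 < t from ht0) (not_le.1 hc)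
    linarith
  have h6 := (Finset.sum_eq_zero_iff_of_nonneg fun i _ => mul_self_nonneg (lam i)).1
    (le_antisymm h5 (Finset.sum_nonneg fun i _ => mul_self_nonneg (lam i)))
  funext i
  exact mul_self_eq_zero.1 (h6 i (Finset.mem_univ i))

/-- Points with `δ* < δ` have a density strictly within the divergence ball. -/
lemma exists_feasDens_of_deltaStar_lt (hΦ : PhiOne φ) (h2 : PhiTwo φ μ g k) {δ : ℝ}
    {θ : Fin dθ → ℝ} {γ : Γ} {P : Vec12 d1 d2} (hS : ConditionS φ μ g θ γ P)
    (hlt : deltaStar φ μ g θ γ P < δ) : ∃ δ' < δ, ∃ f, FeasDens φ μ g δ' θ γ P f := by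
  obtain ⟨δ', h1, h3⟩ := EReal.lt_iff_exists_real_btwn.1 hlt
  refine ⟨δ', EReal.coe_lt_coe_iff.1 h3, ?_⟩
  obtain ⟨f, hf, hf1, hfm, hfδ⟩ := exists_density_of_dual_lt (δ := δ') hΦ (h2.heart_flat hΦ θ γ)
    (fun lam hl h => hS.multiplier_eq_zero hΦ hl h) (fun ζ lam w hl hw hwe => by
      rw [← EReal.coe_lt_coe_iff]
      refine lt_of_le_of_lt ?_ h1
      refine le_sSup (show _ ∈ {x : EReal | _} from ⟨ζ, unflat lam, ?_, w, hw, ?_, ?_⟩)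
      · rw [inLambda_iff, flat_unflat]
        exact hl
      · simpa only [dot4_eq, flat_unflat] using hwe
      · rw [dotP_eq, flat_unflat])
  exact ⟨f, hf, hf1, hfm, hfδ⟩

lemma FeasDens.deltaStar_le (hΦ : PhiOne φ) (h2 : PhiTwo φ μ g k) {δ : ℝ}
    {θ : Fin dθ → ℝ} {γ : Γ} {P : Vec12 d1 d2} {f : U → ℝ} (hf : FeasDens φ μ g δ θ γ P f) :
    deltaStar φ μ g θ γ P ≤ δ := by
  refine sSup_le ?_
  rintro _ ⟨ζ, l, hl, w, hw, hwe, rfl⟩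
  rw [EReal.coe_le_coe_iff]
  have h1 := hf.dens.dual_le hΦ (h2.heart_flat hΦ θ γ) (heart_const 0) (η := 1) (ζ := ζ)
    (lam := flat l) hw (by
      filter_upwards [hwe] with u hu
      rw [hu, etaPhiStar_one, dot4_eq, neg_zero, zero_sub])
  have h3 := hf.moments.sum_le ((inLambda_iff l).1 hl)
  have h4 := hf.le
  rw [hf.one] at h1
  simp only [mul_zero, integral_zero, add_zero, mul_one, one_mul] at h1
  rw [dotP_eq]
  linarith

lemma FeasDens.kappaLowDual_le (hΦ : PhiOne φ) (h2 : PhiTwo φ μ g k) {δ : ℝ}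
    {θ : Fin dθ → ℝ} {γ : Γ} {P : Vec12 d1 d2} {f : U → ℝ} (hf : FeasDens φ μ g δ θ γ P f) :
    kappaLowDual φ μ g k δ θ γ P ≤ ((∫ u, f u * k u θ γ ∂μ : ℝ) : EReal) := by
  refine sSup_le ?_
  rintro _ ⟨η, hη, ζ, l, hl, w, hw, hwe, rfl⟩
  rw [EReal.coe_le_coe_iff]
  have h1 := hf.dens.dual_le hΦ (h2.heart_flat hΦ θ γ) (h2.heart hΦ θ γ) (η := η) (ζ := ζ)
    (lam := flat l) hw (by simpa only [dot4_eq] using hwe)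
  have h3 := hf.moments.sum_le ((inLambda_iff l).1 hl)
  have h4 := mul_le_mul_of_nonneg_left hf.le hη
  rw [hf.one] at h1
  rw [dotP_eq]
  linarith

/-- Strong duality at points with `δ* < δ`. -/
lemma kappaLow_le_kappaLowDual (hΦ : PhiOne φ) (h2 : PhiTwo φ μ g k) {δ : ℝ} (hδ : 0 ≤ δ)
    {θ : Fin dθ → ℝ} {γ : Γ} {P : Vec12 d1 d2} (hS : ConditionS φ μ g θ γ P)
    (hlt : deltaStar φ μ g θ γ P < δ) :
    kappaLow φ μ g k δ θ γ P ≤ kappaLowDual φ μ g k δ θ γ P := by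
  obtain ⟨δ', hδ', f₀, hf₀⟩ := exists_feasDens_of_deltaStar_lt hΦ h2 hS hlt
  by_contra hv
  obtain ⟨v, hv1, hv2⟩ := EReal.lt_iff_exists_real_btwn.1 (not_le.1 hv)
  obtain ⟨η, ζ, lam, w, hη, hl, hw, hwe, hvle⟩ := exists_dual_ge (δ := δ) (v := v) hΦ
    (h2.heart_flat hΦ θ γ) (h2.heart hΦ θ γ) (fun lam hl h => hS.multiplier_eq_zero hΦ hl h)
    hf₀.dens hf₀.one hf₀.moments (hf₀.le.trans_lt hδ') (by
      rintro ⟨f, hf, h1, hm, hle, hk⟩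
      have h3 := (le_kappaLow_iff hΦ h2 hδ).1 le_rfl f ⟨hf, h1, hm, hle⟩
      exact (EReal.coe_lt_coe_iff.1 (hv2.trans_le h3)).not_ge hk)
  refine hv1.not_ge ((EReal.coe_le_coe_iff.2 hvle).trans ?_)
  refine le_sSup (show _ ∈ {x : EReal | _} from
    ⟨η, hη, ζ, unflat lam, ?_, w, hw, ?_, ?_⟩)
  · rw [inLambda_iff, flat_unflat]
    exact hl
  · simpa only [dot4_eq, flat_unflat] using hwe
  · rw [dotP_eq, flat_unflat]

end Translate
end CFSens

namespace CFSens

/-! ### Limits of densities -/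

section Limits

variable {U : Type*} [MeasurableSpace U] {φ : ℝ → ℝ} {μ : Measure U}

lemma unifIntegrable_mul (hΦ : PhiOne φ) {f : ℕ → U → ℝ} {h : U → ℝ} {δ : ℝ}
    (hf : ∀ n, IsDens φ μ (f n)) (hδ : ∀ n, ∫ u, φ (f n u) ∂μ ≤ δ) (hh : Heart φ μ h) :
    UnifIntegrable (fun n u => f n u * h u) 1 μ := by
  have hδ0 : 0 ≤ δ := (integral_nonneg fun u => hΦ.nonneg ((hf 0).nonneg u)).trans (hδ 0)
  intro ε hε
  let c : ℝ := 2 * (δ + 1) / ε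
  have hc : 0 < c := by positivity
  have hcδ : c⁻¹ * δ ≤ ε / 2 := by
    rw [inv_mul_le_iff₀ hc]
    have : c * (ε / 2) = δ + 1 := by simp only [c]; field_simp
    linarith
  have hmem : MemLp (fun u => c⁻¹ * conj φ (c * |h u|)) 1 μ :=
    memLp_one_iff_integrable.2 ((hh.2 c hc).const_mul _)
  obtain ⟨r, hr, hrs⟩ := hmem.eLpNorm_indicator_le le_rfl ENNReal.one_ne_top (half_pos hε)
  refine ⟨r, hr, fun n s hs hμs => ?_⟩
  have hφi : Integrable (fun u => c⁻¹ * φ (f n u)) μ := (hf n).int.const_mul _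
  have h1 : eLpNorm (s.indicator fun u => c⁻¹ * φ (f n u)) 1 μ ≤ ENNReal.ofReal (ε / 2) := by
    refine (eLpNorm_indicator_le _).trans ?_
    rw [eLpNorm_one_eq_lintegral_enorm, ← ofReal_integral_norm_eq_lintegral_enorm hφi]
    refine ENNReal.ofReal_le_ofReal (le_trans (le_of_eq ?_) ((mul_le_mul_of_nonneg_left (hδ n)
      (inv_nonneg.2 hc.le)).trans hcδ))
    rw [← integral_const_mul]
    refine integral_congr_ae (Eventually.of_forall fun u => Real.norm_of_nonneg ?_)
    exact mul_nonneg (inv_nonneg.2 hc.le) (hΦ.nonneg ((hf n).nonneg u))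
  have h2 : eLpNorm (s.indicator fun u => f n u * h u) 1 μ ≤
      eLpNorm ((s.indicator fun u => c⁻¹ * φ (f n u)) +
        s.indicator fun u => c⁻¹ * conj φ (c * |h u|)) 1 μ := by
    refine eLpNorm_mono_real fun u => ?_
    by_cases hu : u ∈ s
    · simp only [indicator_of_mem hu, Pi.add_apply, ← mul_add]
      exact (hf n).mul_le hΦ h u hc
    · simp [hu]
  refine h2.trans ((eLpNorm_add_le (hφi.indicator hs).aestronglyMeasurable
    (hmem.aestronglyMeasurable.indicator hs) le_rfl).trans ?_)
  refine (add_le_add h1 (hrs s hs hμs)).trans (le_of_eq ?_)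
  rw [← ENNReal.ofReal_add (by positivity) (by positivity), add_halves]

variable [IsProbabilityMeasure μ]

/-- Hölder inequality for the Orlicz norm. -/
lemma IsDens.enorm_integral_mul_le (hΦ : PhiOne φ) {f d : U → ℝ} (hf : IsDens φ μ f)
    (hd : Measurable d) :
    ‖∫ u, f u * d u ∂μ‖ₑ ≤ ENNReal.ofReal (∫ u, φ (f u) ∂μ + φ 2 + 2) * psiNorm φ μ d := by
  have hφ2 : 0 ≤ φ 2 := hΦ.nonneg zero_le_two
  have hφf : 0 ≤ ∫ u, φ (f u) ∂μ := integral_nonneg fun u => hΦ.nonneg (hf.nonneg u)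
  have hK0 : ENNReal.ofReal (∫ u, φ (f u) ∂μ + φ 2 + 2) ≠ 0 := by
    rw [Ne, ENNReal.ofReal_eq_zero, not_le]
    positivity
  rw [← ENNReal.div_le_iff' hK0 ENNReal.ofReal_ne_top]
  refine le_iInf₂ fun c hc => ?_
  rw [ENNReal.div_le_iff' hK0 ENNReal.ofReal_ne_top]
  have hc0 : 0 < c := hc
  simp only [hΦ.erealToENNReal_psi]
  set Ψ := ∫⁻ u, ENNReal.ofReal (conj φ (c * |d u|) - c * |d u|) ∂μ with hΨ
  have hpt : ∀ u, ‖f u * d u‖ₑ ≤ (ENNReal.ofReal c)⁻¹ *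
      (ENNReal.ofReal (φ (f u) + φ 2) +
        2 * ENNReal.ofReal (conj φ (c * |d u|) - c * |d u|)) := fun u => by
    have h1 := hf.mul_le hΦ d u hc0
    have h2 := hΦ.conj_le (c * |d u|)
    have h3 := hΦ.le_conj (c * |d u|)
    rw [← ENNReal.ofReal_inv_of_pos hc0, ← ENNReal.ofReal_ofNat 2,
      ← ENNReal.ofReal_mul (by norm_num),
      ← ENNReal.ofReal_add (add_nonneg (hΦ.nonneg (hf.nonneg u)) hφ2) (by linarith),
      ← ENNReal.ofReal_mul (by positivity), Real.enorm_eq_ofReal_abs]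
    refine ENNReal.ofReal_le_ofReal (h1.trans ?_)
    refine mul_le_mul_of_nonneg_left ?_ (by positivity)
    linarith
  have hm1 : Measurable fun u => ENNReal.ofReal (φ (f u) + φ 2) :=
    ((hΦ.measurable_comp hf.meas hf.nonneg).add_const _).ennreal_ofReal
  have hmd : Measurable fun u => c * |d u| := by fun_prop
  have hm2 : Measurable fun u => ENNReal.ofReal (conj φ (c * |d u|) - c * |d u|) :=
    ((hΦ.conj_mono.measurable.comp hmd).sub hmd).ennreal_ofReal
  have h4 : ∫⁻ u, ENNReal.ofReal (φ (f u) + φ 2) ∂μ = ENNReal.ofReal (∫ u, φ (f u) ∂μ + φ 2) := by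
    have hi : Integrable (fun u => φ (f u) + φ 2) μ := hf.int.add (integrable_const _)
    rw [← ofReal_integral_eq_lintegral_ofReal hi
      (Eventually.of_forall fun u => add_nonneg (hΦ.nonneg (hf.nonneg u)) hφ2),
      integral_add hf.int (integrable_const _)]
    simp
  calc ‖∫ u, f u * d u ∂μ‖ₑ ≤ ∫⁻ u, ‖f u * d u‖ₑ ∂μ := enorm_integral_le_lintegral_enorm _
    _ ≤ ∫⁻ u, (ENNReal.ofReal c)⁻¹ * (ENNReal.ofReal (φ (f u) + φ 2) +
        2 * ENNReal.ofReal (conj φ (c * |d u|) - c * |d u|)) ∂μ := lintegral_mono hpt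
    _ = (ENNReal.ofReal c)⁻¹ * (ENNReal.ofReal (∫ u, φ (f u) ∂μ + φ 2) + 2 * Ψ) := by
      have hm3 : Measurable fun u => ENNReal.ofReal (φ (f u) + φ 2) +
          2 * ENNReal.ofReal (conj φ (c * |d u|) - c * |d u|) := hm1.add (hm2.const_mul 2)
      rw [lintegral_const_mul _ hm3, lintegral_add_left hm1, lintegral_const_mul _ hm2, h4]
    _ ≤ (ENNReal.ofReal c)⁻¹ * (ENNReal.ofReal (∫ u, φ (f u) ∂μ + φ 2 + 2) * (1 + Ψ)) := by
      refine mul_le_mul_right ?_ _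
      rw [mul_add, mul_one]
      refine add_le_add (ENNReal.ofReal_le_ofReal (by linarith)) (mul_le_mul_left ?_ _)
      · rw [← ENNReal.ofReal_ofNat 2]
        exact ENNReal.ofReal_le_ofReal (by linarith)
    _ = _ := by ring

lemma tendsto_integral_mul_of_psiNorm (hΦ : PhiOne φ) {f d : ℕ → U → ℝ} {δ : ℝ}
    (hf : ∀ n, IsDens φ μ (f n)) (hδ : ∀ n, ∫ u, φ (f n u) ∂μ ≤ δ) (hd : ∀ n, Measurable (d n))
    (h : Tendsto (fun n => psiNorm φ μ (d n)) atTop (nhds 0)) :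
    Tendsto (fun n => ∫ u, f n u * d n u ∂μ) atTop (nhds 0) := by
  rw [tendsto_zero_iff_enorm_tendsto_zero]
  have h1 := ENNReal.Tendsto.const_mul (a := ENNReal.ofReal (δ + φ 2 + 2)) h
    (Or.inr ENNReal.ofReal_ne_top)
  rw [mul_zero] at h1
  refine tendsto_of_tendsto_of_tendsto_of_le_of_le tendsto_const_nhds h1 (fun _ => zero_le)
    fun n => ((hf n).enorm_integral_mul_le hΦ (hd n)).trans ?_
  gcongr
  exact hδ n

/-- If the divergence of the midpoints with `f` is asymptotically maximal, then a subsequence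
converges, also after integration against the Orlicz heart. -/
lemma exists_subseq_tendsto_integral (hΦ : PhiOne φ) {f : ℕ → U → ℝ} {f₀ h : U → ℝ} {δ : ℝ}
    (hf : ∀ n, IsDens φ μ (f n)) (hδ : ∀ n, ∫ u, φ (f n u) ∂μ ≤ δ) (hf₀ : IsDens φ μ f₀)
    (hδ₀ : ∫ u, φ (f₀ u) ∂μ ≤ δ) (hh : Heart φ μ h)
    (hmid : ∀ ε > 0, ∀ᶠ n in atTop, δ - ε ≤ ∫ u, φ ((f n u + f₀ u) / 2) ∂μ) :
    ∃ ns : ℕ → ℕ, StrictMono ns ∧ Tendsto (fun n => ∫ u, f (ns n) u * h u ∂μ) atTop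
      (nhds (∫ u, f₀ u * h u ∂μ)) := by
  have hmi : ∀ n, Integrable (fun u => φ ((f n u + f₀ u) / 2)) μ := fun n => by
    have := ((hf n).convex_comb hΦ hf₀ (a := 1 / 2) (b := 1 / 2) (by norm_num) (by norm_num)
      (by norm_num)).1.int
    convert this using 3
    ring
  have hgi : ∀ n, Integrable (fun u => gap φ (f n u) (f₀ u)) μ := fun n =>
    (((hf n).int.div_const 2).add (hf₀.int.div_const 2)).sub (hmi n)
  have hgint : ∀ n, ∫ u, gap φ (f n u) (f₀ u) ∂μ ≤ δ - ∫ u, φ ((f n u + f₀ u) / 2) ∂μ := by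
    intro n
    have e : ∫ u, gap φ (f n u) (f₀ u) ∂μ = (∫ u, φ (f n u) ∂μ) / 2 + (∫ u, φ (f₀ u) ∂μ) / 2 -
        ∫ u, φ ((f n u + f₀ u) / 2) ∂μ := by
      have hi : Integrable (fun u => φ (f n u) / 2 + φ (f₀ u) / 2) μ :=
        ((hf n).int.div_const 2).add (hf₀.int.div_const 2)
      simp only [gap]
      rw [integral_sub hi (hmi n), integral_add ((hf n).int.div_const 2) (hf₀.int.div_const 2),
        integral_div, integral_div]
    have := hδ n
    rw [e]
    linarith
  have hg0 : Tendsto (fun n => ∫ u, gap φ (f n u) (f₀ u) ∂μ) atTop (nhds 0) := by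
    refine tendsto_order.2 ⟨fun c hc => Eventually.of_forall fun n => hc.trans_le
      (integral_nonneg fun u => hΦ.gap_nonneg ((hf n).nonneg u) (hf₀.nonneg u)), fun c hc => ?_⟩
    filter_upwards [hmid (c / 2) (half_pos hc)] with n hn
    linarith [hgint n]
  have hmeas : TendstoInMeasure μ (fun n u => gap φ (f n u) (f₀ u)) atTop (fun _ => 0) := by
    refine tendstoInMeasure_of_tendsto_eLpNorm (p := 1) one_ne_zero
      (fun n => (hgi n).aestronglyMeasurable) aestronglyMeasurable_const ?_
    have h1 := ENNReal.tendsto_ofReal hg0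
    rw [ENNReal.ofReal_zero] at h1
    refine h1.congr fun n => ?_
    rw [eLpNorm_one_eq_lintegral_enorm,
      ofReal_integral_eq_lintegral_ofReal (hgi n) (Eventually.of_forall fun u =>
        hΦ.gap_nonneg ((hf n).nonneg u) (hf₀.nonneg u))]
    refine lintegral_congr fun u => ?_
    rw [Pi.sub_apply, sub_zero, Real.enorm_of_nonneg (hΦ.gap_nonneg ((hf n).nonneg u) (hf₀.nonneg u))]
  obtain ⟨ns, hns, hae⟩ := hmeas.exists_seq_tendsto_ae
  refine ⟨ns, hns, ?_⟩
  refine tendsto_integral_of_L1' _ (hf₀.integrable_mul hΦ hh).aestronglyMeasurable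
    (Eventually.of_forall fun n => (hf (ns n)).integrable_mul hΦ hh) ?_
  refine tendsto_Lp_finite_of_tendsto_ae le_rfl ENNReal.one_ne_top
    (fun n => ((hf (ns n)).integrable_mul hΦ hh).aestronglyMeasurable)
    (memLp_one_iff_integrable.2 (hf₀.integrable_mul hΦ hh))
    (unifIntegrable_mul hΦ (fun n => hf (ns n)) (fun n => hδ (ns n)) hh) ?_
  filter_upwards [hae] with u hu
  exact (hΦ.tendsto_of_gap (fun n => (hf (ns n)).nonneg u) (hf₀.nonneg u) hu).mul_const _

end Limits

section Boundary

variable {U : Type*} [MeasurableSpace U] {φ : ℝ → ℝ} {μ : Measure U}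
  {dθ d1 d2 d3 d4 : ℕ} {Γ : Type*} [MetricSpace Γ]
  {g : U → (Fin dθ → ℝ) → Γ → Vec4 d1 d2 d3 d4}
  {k : U → (Fin dθ → ℝ) → Γ → ℝ} {Θ : Set (Fin dθ → ℝ)}

lemma MOneG.flat (h : MOneG φ μ g Θ) (i : MomentIdx d1 d2 d3 d4) :
    EContinuousIn φ μ Θ (fun u θ γ => flat (g u θ γ) i) := by
  obtain ⟨h1, h2, h3, h4⟩ := h
  rcases i with i | i | i | i
  · exact h1 i
  · exact h2 i
  · exact h3 i
  · exact h4 i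

lemma EContinuousIn.tendsto_seq {q : U → (Fin dθ → ℝ) → Γ → ℝ} (h : EContinuousIn φ μ Θ q)
    {θ : Fin dθ → ℝ} (hθ : θ ∈ Θ) (γ : Γ) {x : ℕ → Fin dθ → ℝ} (hx : ∀ n, x n ∈ Θ)
    (hxt : Tendsto x atTop (nhds θ)) :
    Tendsto (fun n => psiNorm φ μ (fun u => q u (x n) γ - q u θ γ)) atTop (nhds 0) := by
  have h1 : Tendsto (fun n => (x n, γ)) atTop (nhdsWithin (θ, γ) (Θ ×ˢ univ)) :=
    tendsto_nhdsWithin_iff.2 ⟨hxt.prodMk_nhds tendsto_const_nhds,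
      Eventually.of_forall fun n => mk_mem_prod (hx n) (mem_univ γ)⟩
  have h2 := Tendsto.comp (h θ hθ γ) h1
  exact h2

variable [IsProbabilityMeasure μ]

/-- The dual bound over the open feasible set extends to feasible densities at its closure. -/
lemma FeasDens.iInf_kappaLowDual_le (hΦ : PhiOne φ) (h2 : PhiTwo φ μ g k)
    (hk : EContinuousIn φ μ Θ k) (hg : MOneG φ μ g Θ) {γ : Γ} {P : Vec12 d1 d2} {δ : ℝ}
    (hS : ∀ θ ∈ ThetaDelta φ μ g Θ γ P δ, ConditionS φ μ g θ γ P)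
    (hcl : {θ ∈ Θ | deltaStar φ μ g θ γ P ≤ δ} ⊆ closure (ThetaDelta φ μ g Θ γ P δ))
    {θ : Fin dθ → ℝ} (hθ : θ ∈ Θ) {f : U → ℝ} (hf : FeasDens φ μ g δ θ γ P f) :
    ⨅ θ ∈ ThetaDelta φ μ g Θ γ P δ, kappaLowDual φ μ g k δ θ γ P ≤
      ((∫ u, f u * k u θ γ ∂μ : ℝ) : EReal) := by
  have hle := hf.deltaStar_le hΦ h2
  rcases hle.lt_or_eq with hlt | heq
  · exact iInf₂_le_of_le θ ⟨hθ, hlt⟩ (hf.kappaLowDual_le hΦ h2)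
  obtain ⟨x, hx, hxt⟩ := mem_closure_iff_seq_limit.1 (hcl ⟨hθ, hle⟩)
  have hxΘ : ∀ n, x n ∈ Θ := fun n => (hx n).1
  have hex : ∀ n, ∃ q, FeasDens φ μ g δ (x n) γ P q := fun n => by
    obtain ⟨δ', hδ', q, hq⟩ := exists_feasDens_of_deltaStar_lt hΦ h2 (hS _ (hx n)) (hx n).2
    exact ⟨q, hq.dens, hq.one, hq.moments, hq.le.trans hδ'.le⟩
  choose q hq using hex
  have hGh := h2.heart_flat hΦ
  have hkh := h2.heart hΦ
  have hlim : ∀ {r : U → (Fin dθ → ℝ) → Γ → ℝ}, (∀ θ, Heart φ μ (fun u => r u θ γ)) →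
      EContinuousIn φ μ Θ r →
      Tendsto (fun n => ∫ u, q n u * r u (x n) γ ∂μ - ∫ u, q n u * r u θ γ ∂μ) atTop (nhds 0) := by
    intro r hr hrc
    refine (tendsto_integral_mul_of_psiNorm hΦ (fun n => (hq n).dens) (fun n => (hq n).le)
      (fun n => (hr (x n)).1.sub (hr θ).1) (hrc.tendsto_seq hθ γ hxΘ hxt)).congr fun n => ?_
    rw [← integral_sub ((hq n).dens.integrable_mul hΦ (hr _)) ((hq n).dens.integrable_mul hΦ (hr _))]
    exact integral_congr_ae (Eventually.of_forall fun u => mul_sub _ _ _)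
  have hmid : ∀ ε > 0, ∀ᶠ n in atTop, δ - ε ≤ ∫ u, φ ((q n u + f u) / 2) ∂μ := by
    intro ε hε
    have h3 : ((δ - ε / 2 : ℝ) : EReal) < deltaStar φ μ g θ γ P := by
      rw [heq, EReal.coe_lt_coe_iff]
      linarith
    obtain ⟨_, ⟨ζ, l, hl, w, hw, hwe, rfl⟩, h4⟩ := lt_sSup_iff.1 h3
    rw [EReal.coe_lt_coe_iff, dotP_eq] at h4
    have hl' := (inLambda_iff l).1 hl
    have h5 : Tendsto (fun n => ∑ i, flat l i * (∫ u, q n u * flat (g u (x n) γ) i ∂μ -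
        ∫ u, q n u * flat (g u θ γ) i ∂μ)) atTop (nhds 0) := by
      have := tendsto_finsetSum Finset.univ fun i _ =>
        (hlim (fun θ => hGh θ γ i) (hg.flat i)).const_mul (flat l i)
      simpa using this
    filter_upwards [h5.eventually (lt_mem_nhds (show -ε < 0 by linarith))] with n hn
    obtain ⟨hd, -⟩ := (hq n).dens.convex_comb hΦ hf.dens (a := 1 / 2) (b := 1 / 2) (by norm_num)
      (by norm_num) (by norm_num)
    have h6 := hd.dual_le hΦ (hGh θ γ) (heart_const 0) (η := 1) (ζ := ζ) (lam := flat l) hw (by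
      filter_upwards [hwe] with u hu
      rw [hu, etaPhiStar_one, dot4_eq, neg_zero, zero_sub])
    have h7 := (hq n).dens.integral_comb_mul hΦ hf.dens (heart_const 1) (1 / 2) (1 / 2)
    simp only [mul_one, (hq n).one, hf.one] at h7
    have h8 : ∑ i, flat l i * ∫ u, (1 / 2 * q n u + 1 / 2 * f u) * flat (g u θ γ) i ∂μ =
        1 / 2 * ∑ i, flat l i * ∫ u, q n u * flat (g u θ γ) i ∂μ +
        1 / 2 * ∑ i, flat l i * ∫ u, f u * flat (g u θ γ) i ∂μ := by
      rw [Finset.mul_sum, Finset.mul_sum, ← Finset.sum_add_distrib]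
      refine Finset.sum_congr rfl fun i _ => ?_
      rw [(hq n).dens.integral_comb_mul hΦ hf.dens (hGh θ γ i)]
      ring
    have h9 := (hq n).moments.sum_le hl'
    have h10 := hf.moments.sum_le hl'
    simp only [mul_sub, Finset.sum_sub_distrib] at hn
    rw [h7, h8] at h6
    simp only [mul_zero, integral_zero, add_zero, one_mul] at h6
    have h11 : ∫ u, φ ((q n u + f u) / 2) ∂μ = ∫ u, φ (1 / 2 * q n u + 1 / 2 * f u) ∂μ := by
      congr 1
      funext u
      congr 1
      ring
    rw [h11]
    linarith
  obtain ⟨ns, hns, hnt⟩ := exists_subseq_tendsto_integral hΦ (fun n => (hq n).dens)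
    (fun n => (hq n).le) hf.dens hf.le (hkh θ γ) hmid
  have hfin : Tendsto (fun n => ∫ u, q (ns n) u * k u (x (ns n)) γ ∂μ) atTop
      (nhds (∫ u, f u * k u θ γ ∂μ)) := by
    have := ((hlim (fun θ => hkh θ γ) hk).comp hns.tendsto_atTop).add hnt
    simpa using this
  refine ge_of_tendsto' ((continuous_coe_real_ereal.tendsto _).comp hfin) fun n => ?_
  exact iInf₂_le_of_le _ (hx (ns n)) ((hq (ns n)).kappaLowDual_le hΦ h2)

end Boundary
end CFSens

namespace CFSens

/-! ### Extreme counterfactuals -/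

section Extreme

variable {U : Type*} [MeasurableSpace U] {φ : ℝ → ℝ} {μ : Measure U}
  {dθ d1 d2 d3 d4 : ℕ} {Γ : Type*}
  {g : U → (Fin dθ → ℝ) → Γ → Vec4 d1 d2 d3 d4}
  {k : U → (Fin dθ → ℝ) → Γ → ℝ}

lemma PhiTwo.neg (h : PhiTwo φ μ g k) : PhiTwo φ μ g (fun u θ γ => -k u θ γ) := fun θ γ => by
  obtain ⟨⟨hm, hc⟩, hg⟩ := h θ γ
  refine ⟨⟨hm.neg, fun c hc0 => ?_⟩, hg⟩
  simpa only [abs_neg] using hc c hc0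

lemma EContinuousIn.neg [TopologicalSpace Γ] {Θ : Set (Fin dθ → ℝ)} (h : EContinuousIn φ μ Θ k) :
    EContinuousIn φ μ Θ (fun u θ γ => -k u θ γ) := fun θ hθ γ => by
  have h1 := h θ hθ γ
  have e : ∀ p : (Fin dθ → ℝ) × Γ, psiNorm φ μ (fun u => -k u p.1 p.2 - -k u θ γ) =
      psiNorm φ μ (fun u => k u p.1 p.2 - k u θ γ) := fun p => by
    have e2 : ∀ u, |-k u p.1 p.2 - -k u θ γ| = |k u p.1 p.2 - k u θ γ| := fun u => by
      rw [← abs_neg]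
      congr 1
      ring
    simp only [psiNorm, e2]
  simpa only [e] using h1

lemma ereal_neg_sInf (s : Set EReal) : -sInf s = sSup (Neg.neg '' s) := by
  rw [sSup_image]
  exact EReal.negOrderIso.map_sInf s

lemma kappaHigh_eq_neg (δ : ℝ) (θ : Fin dθ → ℝ) (γ : Γ) (P : Vec12 d1 d2) :
    kappaHigh φ μ g k δ θ γ P = -kappaLow φ μ g (fun u θ γ => -k u θ γ) δ θ γ P := by
  rw [kappaHigh, kappaLow, ereal_neg_sInf]
  congr 1
  ext x
  constructor
  · rintro ⟨F, hF, hi, rfl⟩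
    refine ⟨_, ⟨F, hF, hi.neg, rfl⟩, ?_⟩
    rw [integral_neg, EReal.coe_neg, neg_neg]
  · rintro ⟨_, ⟨F, hF, hi, rfl⟩, rfl⟩
    refine ⟨F, hF, ?_, ?_⟩
    · simpa using hi.neg
    · rw [integral_neg, EReal.coe_neg, neg_neg]

lemma kappaHighDual_eq_neg (δ : ℝ) (θ : Fin dθ → ℝ) (γ : Γ) (P : Vec12 d1 d2) :
    kappaHighDual φ μ g k δ θ γ P = -kappaLowDual φ μ g (fun u θ γ => -k u θ γ) δ θ γ P := by
  rw [eq_comm, neg_eq_iff_eq_neg, kappaHighDual, kappaLowDual, ereal_neg_sInf]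
  congr 1
  ext x
  constructor
  · rintro ⟨η, hη, ζ, l, hl, w, hw, hwe, rfl⟩
    refine ⟨_, ⟨η, hη, ζ, l, hl, w, hw, ?_, rfl⟩, ?_⟩
    · simpa only [neg_neg] using hwe
    · rw [← EReal.coe_neg]
      congr 1
      ring
  · rintro ⟨_, ⟨η, hη, ζ, l, hl, w, hw, hwe, rfl⟩, rfl⟩
    refine ⟨η, hη, ζ, l, hl, w, hw, ?_, ?_⟩
    · simpa only [neg_neg] using hwe
    · rw [← EReal.coe_neg]
      congr 1
      ring

variable {Θ : Set (Fin dθ → ℝ)} {γ : Γ} {P : Vec12 d1 d2} {δ : ℝ}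

lemma kappaLowImp_eq {kI : (Fin dθ → ℝ) → Γ → ℝ} {θ : Fin dθ → ℝ} {F : Measure U}
    (hF : Feasible φ μ g δ θ γ P F) : kappaLowImp φ μ g kI δ θ γ P = kI θ γ := by
  refine le_antisymm (sInf_le ⟨F, hF, rfl⟩) (le_sInf ?_)
  rintro _ ⟨-, -, rfl⟩
  exact le_rfl

lemma kappaHighImp_eq {kI : (Fin dθ → ℝ) → Γ → ℝ} {θ : Fin dθ → ℝ} {F : Measure U}
    (hF : Feasible φ μ g δ θ γ P F) : kappaHighImp φ μ g kI δ θ γ P = kI θ γ := by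
  refine le_antisymm (sSup_le ?_) (le_sSup ⟨F, hF, rfl⟩)
  rintro _ ⟨-, -, rfl⟩
  exact le_rfl

variable [IsProbabilityMeasure μ]

lemma exists_feasible_of_mem_ThetaDelta (hΦ : PhiOne φ) (h2 : PhiTwo φ μ g k)
    {θ : Fin dθ → ℝ} (hS : ConditionS φ μ g θ γ P)
    (hθ : θ ∈ ThetaDelta φ μ g Θ γ P δ) : ∃ F, Feasible φ μ g δ θ γ P F := by
  obtain ⟨δ', hδ', f, hf⟩ := exists_feasDens_of_deltaStar_lt hΦ h2 hS hθ.2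
  have hf' : FeasDens φ μ g δ θ γ P f := ⟨hf.dens, hf.one, hf.moments, hf.le.trans hδ'.le⟩
  exact ⟨_, hf'.feasible hΦ h2⟩

variable [MetricSpace Γ]

lemma iInf_kappaLow_eq (hΦ : PhiOne φ) (h2 : PhiTwo φ μ g k) (hδ : 0 ≤ δ)
    (hk : EContinuousIn φ μ Θ k) (hg : MOneG φ μ g Θ)
    (hS : ∀ θ ∈ ThetaDelta φ μ g Θ γ P δ, ConditionS φ μ g θ γ P)
    (hcl : {θ ∈ Θ | deltaStar φ μ g θ γ P ≤ δ} ⊆ closure (ThetaDelta φ μ g Θ γ P δ)) :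
    ⨅ θ ∈ Θ, kappaLow φ μ g k δ θ γ P =
      ⨅ θ ∈ ThetaDelta φ μ g Θ γ P δ, kappaLowDual φ μ g k δ θ γ P := by
  refine le_antisymm (le_iInf₂ fun θ hθ => iInf₂_le_of_le θ hθ.1
    (kappaLow_le_kappaLowDual hΦ h2 hδ (hS θ hθ) hθ.2)) (le_iInf₂ fun θ hθ => ?_)
  exact (le_kappaLow_iff hΦ h2 hδ).2 fun f hf =>
    hf.iInf_kappaLowDual_le hΦ h2 hk hg hS hcl hθ

lemma iSup_kappaHigh_eq (hΦ : PhiOne φ) (h2 : PhiTwo φ μ g k) (hδ : 0 ≤ δ)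
    (hk : EContinuousIn φ μ Θ k) (hg : MOneG φ μ g Θ)
    (hS : ∀ θ ∈ ThetaDelta φ μ g Θ γ P δ, ConditionS φ μ g θ γ P)
    (hcl : {θ ∈ Θ | deltaStar φ μ g θ γ P ≤ δ} ⊆ closure (ThetaDelta φ μ g Θ γ P δ)) :
    ⨆ θ ∈ Θ, kappaHigh φ μ g k δ θ γ P =
      ⨆ θ ∈ ThetaDelta φ μ g Θ γ P δ, kappaHighDual φ μ g k δ θ γ P := by
  have h := iInf_kappaLow_eq hΦ h2.neg hδ hk.neg hg hS hcl
  rw [← neg_inj] at h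
  have e : ∀ (s : Set (Fin dθ → ℝ)) (q : (Fin dθ → ℝ) → EReal),
      -⨅ θ ∈ s, q θ = ⨆ θ ∈ s, -q θ := fun s q => by
    simp only [← sInf_image, ereal_neg_sInf, sSup_image, iSup_image]
  simpa only [e, ← kappaHigh_eq_neg, ← kappaHighDual_eq_neg] using h

/-- Parameters at which the model is feasible are limits of points of the open feasible set,
along which the counterfactual converges. -/
lemma Feasible.exists_seq (hΦ : PhiOne φ) (h2 : PhiTwo φ μ g k) (hδ : 0 ≤ δ)
    {kI : (Fin dθ → ℝ) → Γ → ℝ}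
    (hk : ContinuousOn (fun p : (Fin dθ → ℝ) × Γ => kI p.1 p.2) (Θ ×ˢ univ))
    (hcl : {θ ∈ Θ | deltaStar φ μ g θ γ P ≤ δ} ⊆ closure (ThetaDelta φ μ g Θ γ P δ))
    {θ : Fin dθ → ℝ} (hθ : θ ∈ Θ) {F : Measure U} (hF : Feasible φ μ g δ θ γ P F) :
    ∃ x : ℕ → Fin dθ → ℝ, (∀ n, x n ∈ ThetaDelta φ μ g Θ γ P δ) ∧
      Tendsto (fun n => ((kI (x n) γ : ℝ) : EReal)) atTop (nhds (kI θ γ)) := by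
  obtain ⟨f, hf, -⟩ := hF.exists_feasDens hΦ hδ
  obtain ⟨x, hx, hxt⟩ := mem_closure_iff_seq_limit.1 (hcl ⟨hθ, hf.deltaStar_le hΦ h2⟩)
  refine ⟨x, hx, (continuous_coe_real_ereal.tendsto _).comp ?_⟩
  have h1 : Tendsto (fun n => (x n, γ)) atTop (nhdsWithin (θ, γ) (Θ ×ˢ univ)) :=
    tendsto_nhdsWithin_iff.2 ⟨hxt.prodMk_nhds tendsto_const_nhds,
      Eventually.of_forall fun n => mk_mem_prod (hx n).1 (mem_univ γ)⟩
  have h3 := Tendsto.comp (hk (θ, γ) (mk_mem_prod hθ (mem_univ γ))) h1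
  exact h3

lemma iInf_kappaLowImp_eq (hΦ : PhiOne φ) (h2 : PhiTwo φ μ g k) (hδ : 0 ≤ δ)
    {kI : (Fin dθ → ℝ) → Γ → ℝ}
    (hk : ContinuousOn (fun p : (Fin dθ → ℝ) × Γ => kI p.1 p.2) (Θ ×ˢ univ))
    (hS : ∀ θ ∈ ThetaDelta φ μ g Θ γ P δ, ConditionS φ μ g θ γ P)
    (hcl : {θ ∈ Θ | deltaStar φ μ g θ γ P ≤ δ} ⊆ closure (ThetaDelta φ μ g Θ γ P δ)) :
    ⨅ θ ∈ Θ, kappaLowImp φ μ g kI δ θ γ P =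
      ⨅ θ ∈ ThetaDelta φ μ g Θ γ P δ, ((kI θ γ : ℝ) : EReal) := by
  refine le_antisymm (le_iInf₂ fun θ hθ => iInf₂_le_of_le θ hθ.1 ?_) (le_iInf₂ fun θ hθ => ?_)
  · obtain ⟨F, hF⟩ := exists_feasible_of_mem_ThetaDelta hΦ h2 (hS θ hθ) hθ
    exact (kappaLowImp_eq hF).le
  · refine le_sInf ?_
    rintro _ ⟨F, hF, rfl⟩
    obtain ⟨x, hx, hxt⟩ := hF.exists_seq hΦ h2 hδ hk hcl hθ
    exact ge_of_tendsto' hxt fun n => iInf₂_le _ (hx n)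

lemma iSup_kappaHighImp_eq (hΦ : PhiOne φ) (h2 : PhiTwo φ μ g k) (hδ : 0 ≤ δ)
    {kI : (Fin dθ → ℝ) → Γ → ℝ}
    (hk : ContinuousOn (fun p : (Fin dθ → ℝ) × Γ => kI p.1 p.2) (Θ ×ˢ univ))
    (hS : ∀ θ ∈ ThetaDelta φ μ g Θ γ P δ, ConditionS φ μ g θ γ P)
    (hcl : {θ ∈ Θ | deltaStar φ μ g θ γ P ≤ δ} ⊆ closure (ThetaDelta φ μ g Θ γ P δ)) :
    ⨆ θ ∈ Θ, kappaHighImp φ μ g kI δ θ γ P =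
      ⨆ θ ∈ ThetaDelta φ μ g Θ γ P δ, ((kI θ γ : ℝ) : EReal) := by
  refine le_antisymm (iSup₂_le fun θ hθ => ?_) (iSup₂_le fun θ hθ => le_iSup₂_of_le θ hθ.1 ?_)
  · refine sSup_le ?_
    rintro _ ⟨F, hF, rfl⟩
    obtain ⟨x, hx, hxt⟩ := hF.exists_seq hΦ h2 hδ hk hcl hθ
    exact le_of_tendsto' hxt fun n => le_iSup₂ (f := fun θ _ => ((kI θ γ : ℝ) : EReal)) _ (hx n)
  · obtain ⟨F, hF⟩ := exists_feasible_of_mem_ThetaDelta hΦ h2 (hS θ hθ) hθ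
    exact (kappaHighImp_eq hF).ge

end Extreme
end CFSens

open CFSens

/-- **Lemma 3: extreme counterfactuals via the dual over the open feasible set.**
Under Assumptions Φ(i), Φ(ii) and M(i)–(iii),
`κ̲(N_δ) = inf_{θ∈Θ_δ} κ̲*_δ(θ;γ0,P0)` and `κ̄(N_δ) = sup_{θ∈Θ_δ} κ̄*_δ(θ;γ0,P0)` in the
explicit-dependence case, while in the implicit-dependence case (counterfactual `kI(θ,γ)`)
`κ̲(N_δ) = inf_{θ∈Θ_δ} kI(θ,γ0)` and `κ̄(N_δ) = sup_{θ∈Θ_δ} kI(θ,γ0)`. -/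
theorem extreme_counterfactuals_dual_characterization
    {U : Type*} [MeasurableSpace U] {dθ d1 d2 d3 d4 : ℕ} {Γ : Type*} [MetricSpace Γ]
    (φ : ℝ → ℝ) (Fstar : Measure U) [IsProbabilityMeasure Fstar]
    (g : U → (Fin dθ → ℝ) → Γ → Vec4 d1 d2 d3 d4)
    (k : U → (Fin dθ → ℝ) → Γ → ℝ)
    (kI : (Fin dθ → ℝ) → Γ → ℝ)
    (Θ : Set (Fin dθ → ℝ)) (γ0 : Γ) (P0 : Vec12 d1 d2)
    (δ : ℝ) (hδ : 0 < δ)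
    (hΦ1 : PhiOne φ)
    (hΦ2 : PhiTwo φ Fstar g k)
    -- Assumption M(i): ℰ-continuity of k and of each component of g in (θ,γ);
    -- in the implicit-dependence case ℰ-continuity of kI means plain continuity.
    (hM1k : EContinuousIn φ Fstar Θ k)
    (hM1g : MOneG φ Fstar g Θ)
    (hM1kI : ContinuousOn (fun p : (Fin dθ → ℝ) × Γ => kI p.1 p.2) (Θ ×ˢ (Set.univ : Set Γ)))
    -- Assumption M(ii)
    (hM2ne : (ThetaDelta φ Fstar g Θ γ0 P0 δ).Nonempty)
    (hM2S : ∀ θ ∈ ThetaDelta φ Fstar g Θ γ0 P0 δ, ConditionS φ Fstar g θ γ0 P0)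
    -- Assumption M(iii)
    (hM3 : {θ ∈ Θ | deltaStar φ Fstar g θ γ0 P0 ≤ ((δ : ℝ) : EReal)} ⊆
      closure (ThetaDelta φ Fstar g Θ γ0 P0 δ)) :
    (⨅ θ ∈ Θ, kappaLow φ Fstar g k δ θ γ0 P0) =
      (⨅ θ ∈ ThetaDelta φ Fstar g Θ γ0 P0 δ, kappaLowDual φ Fstar g k δ θ γ0 P0) ∧
    (⨆ θ ∈ Θ, kappaHigh φ Fstar g k δ θ γ0 P0) =
      (⨆ θ ∈ ThetaDelta φ Fstar g Θ γ0 P0 δ, kappaHighDual φ Fstar g k δ θ γ0 P0) ∧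
    (⨅ θ ∈ Θ, kappaLowImp φ Fstar g kI δ θ γ0 P0) =
      (⨅ θ ∈ ThetaDelta φ Fstar g Θ γ0 P0 δ, ((kI θ γ0 : ℝ) : EReal)) ∧
    (⨆ θ ∈ Θ, kappaHighImp φ Fstar g kI δ θ γ0 P0) =
      (⨆ θ ∈ ThetaDelta φ Fstar g Θ γ0 P0 δ, ((kI θ γ0 : ℝ) : EReal)) := by
  exact ⟨iInf_kappaLow_eq hΦ1 hΦ2 hδ.le hM1k hM1g hM2S hM3,
    iSup_kappaHigh_eq hΦ1 hΦ2 hδ.le hM1k hM1g hM2S hM3,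
    iInf_kappaLowImp_eq hΦ1 hΦ2 hδ.le hM1kI hM2S hM3,
    iSup_kappaHighImp_eq hΦ1 hΦ2 hδ.le hM1kI hM2S hM3⟩
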